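/- For every integer k ≥ 1, every finite simple graph G of rank width at most k, and every finite simple graph H not isomorphic to G, the stable coloring computed by the (3k+3)-dimensional Weisfeiler–Leman algorithm distinguishes G from H. That is, the Weisfeiler–Leman dimension of the class of graphs of rank width at most k is at most 3k+3. -/

import Mathlib

/-!
Statement 0: the (6k+3)-dimensional Weisfeiler--Leman algorithm identifies graphs of
rank width ≤ k in O(log n) rounds.
-/

/-- The type of color values computed by the `k`-dimensional Weisfeiler--Leman algorithm
after `r` refinement steps (index `0` is the initial/atomic coloring, so index `r`
corresponds to `r + 1` rounds in the convention where the initial coloring is round one). -/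
def WLColorType (k : ℕ) (C : Type) : ℕ → Type
  | 0 => (Fin k → Fin k → Prop) × (Fin k → Fin k → Prop) × (Fin k → C)
  | (r + 1) => WLColorType k C r × Multiset (Fin k → WLColorType k C r)

/-- The `k`-WL coloring of `k`-tuples of vertices of a vertex-colored graph `(G, χ)`:
`wlColor G χ k 0 v̄` is the atomic type of `v̄` (the equality pattern, the adjacency
pattern, and the vertex colors), and
`wlColor G χ k (r+1) v̄ = (wlColor G χ k r v̄, {{(colors of v̄ with i-th entry replaced by x)ᵢ : x ∈ V}})`. -/
def wlColor {V C : Type} [Fintype V] [DecidableEq V] (G : SimpleGraph V) (χ : V → C) (k : ℕ) :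
    (r : ℕ) → (Fin k → V) → WLColorType k C r
  | 0 => fun vb => (fun i j => vb i = vb j, fun i j => G.Adj (vb i) (vb j), fun i => χ (vb i))
  | (r + 1) => fun vb =>
      (wlColor G χ k r vb,
        (Finset.univ : Finset V).val.map fun x i => wlColor G χ k r (Function.update vb i x))

/-- The multiset `{{χ_{k,r}(v̄) : v̄ ∈ V^k}}` of `k`-WL colors of all `k`-tuples:
two graphs are distinguished by `(k, r+1)`-round WL iff these multisets differ. -/
def wlMultiset {V C : Type} [Fintype V] [DecidableEq V] (G : SimpleGraph V) (χ : V → C)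
    (k r : ℕ) : Multiset (WLColorType k C r) :=
  (Finset.univ : Finset (Fin k → V)).val.map (wlColor G χ k r)

open Classical in
/-- `ρ_G(X)`: the `F₂`-rank of the `X × X̄` cut matrix `M(X, X̄)` whose `(u, w)` entry is `1`
iff `uw ∈ E(G)`. -/
noncomputable def cutRank {V : Type} [Fintype V] [DecidableEq V] (G : SimpleGraph V)
    (X : Finset V) : ℕ :=
  (Matrix.of fun (u : ↥X) (w : ↥(Xᶜ)) => if G.Adj ↑u ↑w then (1 : ZMod 2) else 0).rank

/-- Binary rooted trees with leaves labelled by vertices.  Such a tree `T` (with each vertex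
occurring at exactly one leaf) determines a rank decomposition `(T, γ)`, where `γ(t)` is the
set of leaf labels below `t`. -/
inductive RWTree (V : Type) : Type
  | leaf : V → RWTree V
  | node : RWTree V → RWTree V → RWTree V

namespace RWTree

/-- The multiset of leaf labels of a tree, i.e. `γ(t)` (with multiplicities). -/
def leaves {V : Type} : RWTree V → Multiset V
  | leaf v => {v}
  | node l r => leaves l + leaves r

/-- The list of all subtrees (one for each node) of a tree. -/
def subtrees {V : Type} : RWTree V → List (RWTree V)
  | leaf v => [leaf v]
  | node l r => node l r :: (subtrees l ++ subtrees r)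

end RWTree

/-- `G` has rank width at most `k`: there is a rank decomposition, given by a binary rooted
tree whose leaves are labelled bijectively by the vertices of `G`, all of whose nodes `t`
satisfy `ρ_G(γ(t)) ≤ k`. -/
def RankwidthLE {V : Type} [Fintype V] [DecidableEq V] (G : SimpleGraph V) (k : ℕ) : Prop :=
  ∃ t : RWTree V, t.leaves = (Finset.univ : Finset V).val ∧
    ∀ s ∈ t.subtrees, cutRank G s.leaves.toFinset ≤ k

/-- Abstract properties of positions of the bijective pebble game. -/
structure PGame {V W : Type} [Fintype V] [DecidableEq V] [Fintype W] [DecidableEq W]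
    (G : SimpleGraph V) (H : SimpleGraph W) (N : ℕ) (Good : Finset (V × W) → Prop) : Prop where
  mono : ∀ {S T : Finset (V × W)}, S ⊆ T → Good T → Good S
  eqv : ∀ {S : Finset (V × W)}, Good S → ∀ p ∈ S, ∀ q ∈ S, (p.1 = q.1 ↔ p.2 = q.2)
  adj : ∀ {S : Finset (V × W)}, Good S → ∀ p ∈ S, ∀ q ∈ S, (G.Adj p.1 q.1 ↔ H.Adj p.2 q.2)
  ext : ∀ {S : Finset (V × W)}, Good S → ∃ σ : V ≃ W, ∀ x, ∀ T ⊆ S, T.card < N →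
    Good (insert (x, σ x) T)

section WLpart
variable {V W : Type} [Fintype V] [DecidableEq V] [Fintype W] [DecidableEq W]

theorem wl_exists_equiv {C : Type*} (f : V → C) (g : W → C)
    (h : (Finset.univ : Finset V).val.map f = (Finset.univ : Finset W).val.map g) :
    ∃ σ : V ≃ W, ∀ x, f x = g (σ x) := by
  classical
  have hf : ∀ c, Nonempty ({x // f x = c} ≃ {y // g y = c}) := by
    intro c
    have h1 := congrArg (Multiset.count c) h
    rw [Multiset.count_map, Multiset.count_map] at h1
    refine ⟨Fintype.equivOfCardEq ?_⟩
    rw [Fintype.card_subtype, Fintype.card_subtype]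
    simp only [Finset.card_def, Finset.filter_val]
    simpa only [eq_comm] using h1
  let e : ∀ c, {x // f x = c} ≃ {y // g y = c} := fun c => (hf c).some
  refine ⟨(Equiv.sigmaFiberEquiv f).symm.trans
    ((Equiv.sigmaCongrRight e).trans (Equiv.sigmaFiberEquiv g)), fun x => ?_⟩
  exact ((e (f x)) ⟨x, rfl⟩).2.symm

theorem wlColor_mono (G : SimpleGraph V) (H : SimpleGraph W) (N : ℕ) (v : Fin N → V)
    (w : Fin N → W) {r s : ℕ} (hrs : r ≤ s)
    (h : wlColor G (fun _ => ()) N s v = wlColor H (fun _ => ()) N s w) :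
    wlColor G (fun _ => ()) N r v = wlColor H (fun _ => ()) N r w := by
  induction hrs with
  | refl => exact h
  | step _ ih => exact ih (Prod.ext_iff.mp h).1

def WLEq (G : SimpleGraph V) (H : SimpleGraph W) (N : ℕ) (v : Fin N → V) (w : Fin N → W) : Prop :=
  ∀ r, wlColor G (fun _ => ()) N r v = wlColor H (fun _ => ()) N r w

theorem WLEq.ext {G : SimpleGraph V} {H : SimpleGraph W} {N : ℕ} {v : Fin N → V} {w : Fin N → W}
    (h : WLEq G H N v w) :
    ∃ σ : V ≃ W, ∀ x i, WLEq G H N (Function.update v i x) (Function.update w i (σ x)) := by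
  classical
  by_contra hcon
  push Not at hcon
  have : ∀ σ : V ≃ W, ∃ r, ∃ x i, wlColor G (fun _ => ()) N r (Function.update v i x) ≠
      wlColor H (fun _ => ()) N r (Function.update w i (σ x)) := by
    intro σ
    obtain ⟨x, i, hx⟩ := hcon σ
    unfold WLEq at hx
    push Not at hx
    obtain ⟨r, hr⟩ := hx
    exact ⟨r, x, i, hr⟩
  choose r hr using this
  let R := Finset.univ.sup r
  obtain ⟨σ, hσ⟩ := wl_exists_equiv _ _ (Prod.ext_iff.mp (h (R + 1))).2
  obtain ⟨x, i, hx⟩ := hr σ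
  apply hx
  apply wlColor_mono G H N _ _ (s := R) (Finset.le_sup (f := r) (Finset.mem_univ σ))
  exact congrFun (hσ x) i

def WLGood (G : SimpleGraph V) (H : SimpleGraph W) (N : ℕ) (S : Finset (V × W)) : Prop :=
  ∃ v w, WLEq G H N v w ∧ ∀ p ∈ S, ∃ i, v i = p.1 ∧ w i = p.2

theorem wlGood_game (G : SimpleGraph V) (H : SimpleGraph W) (N : ℕ) :
    PGame G H N (WLGood G H N) where
  mono := by
    rintro S T hST ⟨v, w, h, hp⟩
    exact ⟨v, w, h, fun p hpS => hp p (hST hpS)⟩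
  eqv := by
    rintro S ⟨v, w, h, hp⟩ p hpS q hqS
    obtain ⟨i, hi, hi'⟩ := hp p hpS
    obtain ⟨j, hj, hj'⟩ := hp q hqS
    have := congrFun (congrFun (Prod.ext_iff.mp (h 0)).1 i) j
    rw [← hi, ← hj, ← hi', ← hj']
    exact iff_of_eq this
  adj := by
    rintro S ⟨v, w, h, hp⟩ p hpS q hqS
    obtain ⟨i, hi, hi'⟩ := hp p hpS
    obtain ⟨j, hj, hj'⟩ := hp q hqS
    have := congrFun (congrFun (Prod.ext_iff.mp (Prod.ext_iff.mp (h 0)).2).1 i) j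
    rw [← hi, ← hj, ← hi', ← hj']
    exact iff_of_eq this
  ext := by
    rintro S ⟨v, w, h, hp⟩
    obtain ⟨σ, hσ⟩ := h.ext
    refine ⟨σ, fun x T hTS hT => ?_⟩
    have : Nonempty (Fin N) := ⟨⟨0, by omega⟩⟩
    choose! f hf using hp
    have : ∃ i, i ∉ T.image f := by
      by_contra hcon
      push Not at hcon
      have h1 : (Finset.univ : Finset (Fin N)) ⊆ T.image f := fun i _ => hcon i
      have h2 := Finset.card_le_card h1
      have h3 := Finset.card_image_le (s := T) (f := f)
      simp at h2
      omega
    obtain ⟨i, hi⟩ := this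
    refine ⟨_, _, hσ x i, fun p hp => ?_⟩
    rw [Finset.mem_insert] at hp
    rcases hp with rfl | hp
    · exact ⟨i, by simp⟩
    · refine ⟨f p, ?_⟩
      have hne : f p ≠ i := fun h => hi (h ▸ Finset.mem_image_of_mem f hp)
      rw [Function.update_of_ne hne, Function.update_of_ne hne]
      exact hf p (hTS hp)

theorem wlGood_empty [Nonempty V] (G : SimpleGraph V) (H : SimpleGraph W) (N : ℕ)
    (h : ∀ r, wlMultiset G (fun _ => ()) N r = wlMultiset H (fun _ => ()) N r) :
    WLGood G H N ∅ := by
  classical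
  let v : Fin N → V := fun _ => Classical.arbitrary V
  suffices ∃ w, WLEq G H N v w by
    obtain ⟨w, hw⟩ := this
    exact ⟨v, w, hw, by simp⟩
  by_contra hcon
  unfold WLEq at hcon
  push Not at hcon
  choose r hr using hcon
  let R := Finset.univ.sup r
  obtain ⟨σ, hσ⟩ := wl_exists_equiv _ _ (h R)
  exact hr (σ v) (wlColor_mono G H N _ _ (Finset.le_sup (f := r) (Finset.mem_univ _)) (hσ v))

end WLpart

section LinAlg
set_option linter.unusedSectionVars false
set_option linter.unusedSimpArgs false
variable {V : Type} [Fintype V] [DecidableEq V]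

open Classical in
noncomputable def rowv (G : SimpleGraph V) (X : Finset V) (v : V) : V → ZMod 2 :=
  fun w => if w ∈ X then 0 else if G.Adj v w then 1 else 0

def selMap {ι κ : Type} (c : κ → Option ι) : (ι → ZMod 2) →ₗ[ZMod 2] (κ → ZMod 2) where
  toFun f w := (c w).elim 0 f
  map_add' f g := by
    funext w
    cases h : c w <;> simp [h]
  map_smul' a f := by
    funext w
    cases h : c w <;> simp [h]

theorem selMap_apply {ι κ : Type} (c : κ → Option ι) (f : ι → ZMod 2) (w : κ) :
    selMap c f w = (c w).elim 0 f := rfl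

def LowRank (G : SimpleGraph V) (k : ℕ) (X : Finset V) : Prop :=
  Module.finrank (ZMod 2) (Submodule.span (ZMod 2) (rowv G X '' X)) ≤ k ∧
  Module.finrank (ZMod 2) (Submodule.span (ZMod 2) (rowv G Xᶜ '' (Xᶜ : Finset V))) ≤ k

theorem finrank_span_le_of_map {ι κ : Type} [Finite ι] [Finite κ]
    (L : (ι → ZMod 2) →ₗ[ZMod 2] (κ → ZMod 2)) (s : Set (ι → ZMod 2)) (t : Set (κ → ZMod 2))
    (h : t ⊆ (Submodule.span (ZMod 2) s).map L) :
    Module.finrank (ZMod 2) (Submodule.span (ZMod 2) t) ≤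
      Module.finrank (ZMod 2) (Submodule.span (ZMod 2) s) :=
  (Submodule.finrank_mono (Submodule.span_le.mpr h)).trans (Submodule.finrank_map_le L _)

theorem lowRank_of_cutRank {G : SimpleGraph V} {k : ℕ} {X : Finset V} (h : cutRank G X ≤ k) :
    LowRank G k X := by
  classical
  unfold cutRank at h
  constructor
  · rw [Matrix.rank_eq_finrank_span_row] at h
    refine le_trans (finrank_span_le_of_map
      (selMap fun w => if hw : w ∈ Xᶜ then some ⟨w, hw⟩ else none) _ _ ?_) h
    rintro _ ⟨x, hx, rfl⟩
    refine ⟨_, Submodule.subset_span ⟨⟨x, hx⟩, rfl⟩, ?_⟩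
    funext w
    rw [selMap_apply]
    by_cases hw : w ∈ X <;> simp [hw, rowv, Matrix.row]
  · rw [← Matrix.rank_transpose, Matrix.rank_eq_finrank_span_row] at h
    refine le_trans (finrank_span_le_of_map
      (selMap fun w => if hw : w ∈ X then some ⟨w, hw⟩ else none) _ _ ?_) h
    rintro _ ⟨x, hx, rfl⟩
    refine ⟨_, Submodule.subset_span ⟨⟨x, hx⟩, rfl⟩, ?_⟩
    funext w
    rw [selMap_apply]
    by_cases hw : w ∈ X <;> simp [hw, rowv, Matrix.row, G.adj_comm]

theorem card_le_of_indep {G : SimpleGraph V} {X A : Finset V} (hA : A ⊆ X)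
    (hi : LinearIndepOn (ZMod 2) (rowv G X) (A : Set V)) :
    A.card ≤ Module.finrank (ZMod 2) (Submodule.span (ZMod 2) (rowv G X '' X)) := by
  have h1 : LinearIndependent (ZMod 2) (fun a : A => rowv G X a) := hi
  have h2 := finrank_span_eq_card h1
  rw [Fintype.card_coe] at h2
  rw [← h2]
  apply Submodule.finrank_mono
  apply Submodule.span_mono
  rintro _ ⟨a, rfl⟩
  exact ⟨a, hA a.2, rfl⟩

/-- one-sided spanning -/
def Spans (G : SimpleGraph V) (X A : Finset V) : Prop :=
  ∀ x ∈ X, rowv G X x ∈ Submodule.span (ZMod 2) (rowv G X '' A)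

structure SP (G : SimpleGraph V) (k : ℕ) (X A B : Finset V) : Prop where
  hA : A ⊆ X
  hAi : LinearIndepOn (ZMod 2) (rowv G X) (A : Set V)
  hAs : Spans G X A
  hAc : A.card ≤ k
  hB : B ⊆ Xᶜ
  hBs : Spans G Xᶜ B
  hBc : B.card ≤ k

theorem rowv_eq_iff (G : SimpleGraph V) (X : Finset V) {w z : V} (hw : w ∉ X) (hz : z ∉ X)
    (u v : V) : rowv G X u w = rowv G X v z ↔ (G.Adj u w ↔ G.Adj v z) := by
  unfold rowv
  rw [if_neg hw, if_neg hz]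
  by_cases h1 : G.Adj u w <;> by_cases h2 : G.Adj v z <;> simp [h1, h2]

theorem Spans.sep {G : SimpleGraph V} {X A : Finset V} (h : Spans G X A) {w z : V}
    (hw : w ∉ X) (hz : z ∉ X) (ha : ∀ a ∈ A, (G.Adj a w ↔ G.Adj a z)) {x : V} (hx : x ∈ X) :
    G.Adj x w ↔ G.Adj x z := by
  rw [← rowv_eq_iff G X hw hz]
  have h1 := h x hx
  refine Submodule.span_induction (p := fun f _ => f w = f z) ?_ rfl ?_ ?_ h1
  · rintro _ ⟨a, ha', rfl⟩
    exact (rowv_eq_iff G X hw hz a a).mpr (ha a ha')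
  · intro f g _ _ hf hg
    simp [hf, hg]
  · intro c f _ hf
    simp [hf]

theorem SP.det {G : SimpleGraph V} {k : ℕ} {X A B : Finset V} (h : SP G k X A B) {u u' w w' : V}
    (hu : u ∈ X) (hu' : u' ∈ X) (hw : w ∉ X) (hw' : w' ∉ X)
    (hb : ∀ b ∈ B, (G.Adj u b ↔ G.Adj u' b)) (ha : ∀ a ∈ A, (G.Adj w a ↔ G.Adj w' a)) :
    G.Adj u w ↔ G.Adj u' w' := by
  have h1 : G.Adj w u ↔ G.Adj w u' :=
    h.hBs.sep (by simpa using hu) (by simpa using hu')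
      (fun b hb' => by rw [G.adj_comm b, G.adj_comm b]; exact hb b hb') (by simpa using hw)
  have h2 : G.Adj u' w ↔ G.Adj u' w' :=
    h.hAs.sep hw hw' (fun a ha' => by rw [G.adj_comm a, G.adj_comm a]; exact ha a ha') hu'
  rw [G.adj_comm, h1, G.adj_comm, h2]

theorem exists_basis (G : SimpleGraph V) {X A Q : Finset V} (hQ : Q ⊆ X) (hAQ : A ⊆ Q)
    (hA : LinearIndepOn (ZMod 2) (rowv G X) (A : Set V)) (hs : Spans G X Q) :
    ∃ B : Finset V, A ⊆ B ∧ B ⊆ Q ∧ LinearIndepOn (ZMod 2) (rowv G X) (B : Set V) ∧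
      Spans G X B ∧ B.card ≤ Module.finrank (ZMod 2) (Submodule.span (ZMod 2) (rowv G X '' X)) := by
  classical
  obtain ⟨b, hb, hAb, hsp, hi⟩ := exists_linearIndepOn_extension hA (Finset.coe_subset.mpr hAQ)
  obtain ⟨B, rfl⟩ : ∃ B : Finset V, (B : Set V) = b := ⟨b.toFinset, by simp⟩
  rw [Finset.coe_subset] at hb hAb
  refine ⟨B, hAb, hb, hi, fun x hx => ?_, card_le_of_indep (hb.trans hQ) hi⟩
  exact (Submodule.span_le.mpr hsp) (hs x hx)

theorem rowv_mask (G : SimpleGraph V) (X Y : Finset V) (h : X ⊆ Y) (v : V) :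
    selMap (fun w => if w ∈ Y then none else some w) (rowv G X v) = rowv G Y v := by
  funext w
  rw [selMap_apply]
  by_cases hw : w ∈ Y
  · simp [hw, rowv]
  · have : w ∉ X := fun h' => hw (h h')
    simp [hw, this, rowv]

theorem mem_span_map {ι κ : Type} {L : (ι → ZMod 2) →ₗ[ZMod 2] (κ → ZMod 2)}
    {s : Set (ι → ZMod 2)} {t : Set (κ → ZMod 2)} {x : ι → ZMod 2}
    (hx : x ∈ Submodule.span (ZMod 2) s) (h : ∀ y ∈ s, L y ∈ Submodule.span (ZMod 2) t) :
    L x ∈ Submodule.span (ZMod 2) t := by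
  have : Submodule.span (ZMod 2) s ≤ (Submodule.span (ZMod 2) t).comap L :=
    Submodule.span_le.mpr h
  exact this hx

/-- nice triples -/
theorem SP.nice {G : SimpleGraph V} {k : ℕ} {X1 X2 A B : Finset V} (hd : Disjoint X1 X2)
    (h : SP G k (X1 ∪ X2) A B) (h1 : LowRank G k X1) (h2 : LowRank G k X2) :
    ∃ A1 A2 B1 B2, SP G k X1 A1 B1 ∧ SP G k X2 A2 B2 ∧ A ⊆ A1 ∪ A2 ∧ B1 ⊆ A2 ∪ B ∧ B2 ⊆ A1 ∪ B := by
  classical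
  have key : ∀ X : Finset V, X ⊆ X1 ∪ X2 → LowRank G k X → ∃ A1 : Finset V, A ∩ X ⊆ A1 ∧ A1 ⊆ X ∧
      LinearIndepOn (ZMod 2) (rowv G X) (A1 : Set V) ∧ Spans G X A1 ∧ A1.card ≤ k := by
    intro X hX hl
    have hi : LinearIndepOn (ZMod 2) (rowv G X) ((A ∩ X : Finset V) : Set V) := by
      apply LinearIndepOn.of_comp (selMap (fun w => if w ∈ X1 ∪ X2 then none else some w))
      have : (selMap (fun w => if w ∈ X1 ∪ X2 then none else some w)) ∘ rowv G X
        = rowv G (X1 ∪ X2) := by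
        funext v
        exact rowv_mask G X _ hX v
      rw [this]
      exact h.hAi.mono (by simp)
    obtain ⟨A1, ha, hb, hc, hd, he⟩ := exists_basis G (Finset.Subset.refl X)
      Finset.inter_subset_right hi (fun x hx => Submodule.subset_span ⟨x, hx, rfl⟩)
    exact ⟨A1, ha, hb, hc, hd, he.trans hl.1⟩
  obtain ⟨A1, ha1, hb1, hc1, hd1, he1⟩ := key X1 Finset.subset_union_left h1
  obtain ⟨A2, ha2, hb2, hc2, hd2, he2⟩ := key X2 Finset.subset_union_right h2
  have keyB : ∀ X Y A' : Finset V, Disjoint X Y → X ∪ Y = X1 ∪ X2 → A' ⊆ Y → Spans G Y A' →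
      LowRank G k X → ∃ B1 ⊆ A' ∪ B, B1 ⊆ Xᶜ ∧ Spans G Xᶜ B1 ∧ B1.card ≤ k := by
    intro X Y A' hXY hun hA' hs hl
    rw [← hun] at h
    have hYX : Y ⊆ Xᶜ := fun y hy => by
      simpa using fun hx => (Finset.disjoint_left.mp hXY hx hy)
    have hUX : (X ∪ Y)ᶜ ⊆ Xᶜ := by
      rw [Finset.compl_subset_compl]; exact Finset.subset_union_left
    have hsub : A' ∪ B ⊆ Xᶜ := Finset.union_subset (hA'.trans hYX) (h.hB.trans hUX)
    obtain ⟨B1, -, h2, -, h4, h5⟩ := exists_basis G (A := ∅) (X := Xᶜ) hsub (by simp)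
      (by simp) (by
        intro x hx
        by_cases hxY : x ∈ Y
        · have := hs x hxY
          rw [← rowv_mask G Y Xᶜ hYX]
          refine mem_span_map this ?_
          rintro _ ⟨a, ha, rfl⟩
          rw [rowv_mask G Y Xᶜ hYX]
          exact Submodule.subset_span ⟨a, by simp at ha; simp [ha], rfl⟩
        · have := h.hBs x (by simp at hx; simp [hx, hxY])
          rw [← rowv_mask G _ Xᶜ hUX]
          refine mem_span_map this ?_
          rintro _ ⟨a, ha, rfl⟩
          rw [rowv_mask G _ Xᶜ hUX]
          exact Submodule.subset_span ⟨a, by simp at ha; simp [ha], rfl⟩)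
    exact ⟨B1, h2, h2.trans hsub, h4, h5.trans hl.2⟩
  obtain ⟨B1, hf1, hg1, hh1, hj1⟩ := keyB X1 X2 A2 hd rfl hb2 hd2 h1
  obtain ⟨B2, hf2, hg2, hh2, hj2⟩ := keyB X2 X1 A1 hd.symm (Finset.union_comm _ _) hb1 hd1 h2
  refine ⟨A1, A2, B1, B2, ⟨hb1, hc1, hd1, he1, hg1, hh1, hj1⟩,
    ⟨hb2, hc2, hd2, he2, hg2, hh2, hj2⟩, fun a ha => ?_, hf1, hf2⟩
  have := h.hA ha
  rw [Finset.mem_union] at this ⊢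
  rcases this with h' | h'
  · exact Or.inl (ha1 (Finset.mem_inter.mpr ⟨ha, h'⟩))
  · exact Or.inr (ha2 (Finset.mem_inter.mpr ⟨ha, h'⟩))

/-- `Z` is separated from `X \ Z` by columns which appear outside `X`. -/
def SelOK (G : SimpleGraph V) (X Z : Finset V) : Prop :=
  ∀ w ∈ X, w ∉ Z → (∀ u ∈ Z, ¬ G.Adj u w) ∨ ∃ z ∉ X, ∀ u ∈ Z, (G.Adj u w ↔ G.Adj u z)

theorem SelOK.exists_map {G : SimpleGraph V} {X Z T : Finset V} (h : SelOK G X Z) (hT : T ⊆ X) :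
    ∃ L : (V → ZMod 2) →ₗ[ZMod 2] (V → ZMod 2), ∀ u ∈ T ∩ Z, L (rowv G T u) = rowv G (T ∩ Z) u := by
  classical
  have : ∀ w, ∃ o : Option V, ∀ u ∈ T ∩ Z, o.elim 0 (rowv G T u) = rowv G (T ∩ Z) u w := by
    intro w
    by_cases h1 : w ∈ T
    · by_cases h2 : w ∈ Z
      · exact ⟨none, fun u _ => by simp [rowv, h1, h2]⟩
      · rcases h w (hT h1) h2 with h3 | ⟨z, hz, h3⟩
        · exact ⟨none, fun u hu => by simp [rowv, h2, h3 u (Finset.mem_inter.mp hu).2]⟩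
        · refine ⟨some z, fun u hu => ?_⟩
          have : z ∉ T := fun h => hz (hT h)
          simp [rowv, h2, this, h3 u (Finset.mem_inter.mp hu).2]
    · exact ⟨some w, fun u _ => by simp [rowv, h1]⟩
  choose c hc using this
  refine ⟨selMap c, fun u hu => ?_⟩
  funext w
  exact hc w u hu

theorem SelOK.lowRank {G : SimpleGraph V} {k : ℕ} {X Z T : Finset V} (h : SelOK G X Z) (hT : T ⊆ X)
    (hl : LowRank G k T) : LowRank G k (T ∩ Z) := by
  classical
  constructor
  · obtain ⟨L, hL⟩ := h.exists_map hT
    refine le_trans (finrank_span_le_of_map L _ _ ?_) hl.1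
    rintro _ ⟨u, hu, rfl⟩
    exact ⟨_, Submodule.subset_span ⟨u, (Finset.mem_inter.mp hu).1, rfl⟩, hL u hu⟩
  · refine le_trans (finrank_span_le_of_map
      (selMap (fun w => if w ∈ (T ∩ Z)ᶜ then none else some w)) _ _ ?_) hl.2
    have hsub : Tᶜ ⊆ (T ∩ Z)ᶜ := by
      rw [Finset.compl_subset_compl]; exact Finset.inter_subset_left
    rintro _ ⟨w, hw, rfl⟩
    by_cases h1 : w ∈ T
    · have h2 : w ∉ Z := by
        simp at hw
        exact hw.resolve_left (fun h => h h1)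
      rcases h w (hT h1) h2 with h3 | ⟨z, hz, h3⟩
      · refine ⟨0, Submodule.zero_mem _, ?_⟩
        rw [map_zero]
        funext u
        by_cases hu : u ∈ T ∩ Z
        · have := h3 u (Finset.mem_inter.mp hu).2
          rw [G.adj_comm] at this
          simp [rowv, this]
        · have hu1 : u ∈ (T ∩ Z)ᶜ := Finset.mem_compl.mpr hu
          simp only [rowv, if_pos hu1, Pi.zero_apply]
      · have hzT : z ∉ T := fun h => hz (hT h)
        refine ⟨_, Submodule.subset_span ⟨z, by simpa using hzT, rfl⟩, ?_⟩
        rw [rowv_mask G _ _ hsub]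
        funext u
        by_cases hu : u ∈ T ∩ Z
        · have := h3 u (Finset.mem_inter.mp hu).2
          rw [G.adj_comm, G.adj_comm u] at this
          simp [rowv, this]
        · have hu1 : u ∈ (T ∩ Z)ᶜ := Finset.mem_compl.mpr hu
          simp only [rowv, if_pos hu1, Pi.zero_apply]
    · refine ⟨_, Submodule.subset_span ⟨w, by simpa using h1, rfl⟩, ?_⟩
      rw [rowv_mask G _ _ hsub]

theorem SP.restrict {G : SimpleGraph V} {k : ℕ} {X A B Z : Finset V} (h : SP G k X A B)
    (hAZ : A ⊆ Z) (hZX : Z ⊆ X) (hs : SelOK G X Z) : SP G k Z A B := by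
  classical
  have hXZ : Xᶜ ⊆ Zᶜ := Finset.compl_subset_compl.mpr hZX
  refine ⟨hAZ, ?_, ?_, h.hAc, h.hB.trans hXZ, ?_, h.hBc⟩
  · apply LinearIndepOn.of_comp (selMap (fun w => if w ∈ X then none else some w))
    have : (selMap (fun w => if w ∈ X then none else some w)) ∘ rowv G Z = rowv G X := by
      funext v
      exact rowv_mask G Z X hZX v
    rw [this]
    exact h.hAi
  · obtain ⟨L, hL⟩ := hs.exists_map (Finset.Subset.refl X)
    rw [Finset.inter_eq_right.mpr hZX] at hL
    intro x hx
    rw [← hL x hx]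
    refine mem_span_map (h.hAs x (hZX hx)) ?_
    rintro _ ⟨a, ha, rfl⟩
    rw [hL a (hAZ ha)]
    exact Submodule.subset_span ⟨a, ha, rfl⟩
  · have base : ∀ w ∉ X, rowv G Zᶜ w ∈ Submodule.span (ZMod 2) (rowv G Zᶜ '' B) := by
      intro w hw
      rw [← rowv_mask G _ _ hXZ]
      refine mem_span_map (h.hBs w (by simpa using hw)) ?_
      rintro _ ⟨a, ha, rfl⟩
      rw [rowv_mask G _ _ hXZ]
      exact Submodule.subset_span ⟨a, ha, rfl⟩
    intro w hw
    by_cases hwX : w ∈ X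
    · rcases hs w hwX (by simpa using hw) with h3 | ⟨z, hz, h3⟩
      · have : rowv G Zᶜ w = 0 := by
          funext u
          by_cases hu : u ∈ Z
          · have := h3 u hu
            rw [G.adj_comm] at this
            simp [rowv, this]
          · simp [rowv, hu]
        rw [this]
        exact Submodule.zero_mem _
      · have : rowv G Zᶜ w = rowv G Zᶜ z := by
          funext u
          by_cases hu : u ∈ Z
          · have := h3 u hu
            rw [G.adj_comm, G.adj_comm u] at this
            simp [rowv, this]
          · simp [rowv, hu]
        rw [this]
        exact base z hz
    · exact base w hwX

inductive Dec (G : SimpleGraph V) (k : ℕ) : Finset V → Prop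
  | leaf (y : V) : Dec G k {y}
  | node (X Y : Finset V) (hd : Disjoint X Y) (hX : Dec G k X) (hY : Dec G k Y)
      (h1 : LowRank G k X) (h2 : LowRank G k Y) : Dec G k (X ∪ Y)

theorem Dec.nonempty {G : SimpleGraph V} {k : ℕ} {X : Finset V} (h : Dec G k X) : X.Nonempty := by
  induction h with
  | leaf y => simp
  | node X Y _ _ _ _ _ h1 _ => exact h1.mono Finset.subset_union_left

theorem Dec.restrict {G : SimpleGraph V} {k : ℕ} {X Z T : Finset V} (hs : SelOK G X Z)
    (h : Dec G k T) (hT : T ⊆ X) (hne : (T ∩ Z).Nonempty) : Dec G k (T ∩ Z) := by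
  induction h with
  | leaf y =>
    have : y ∈ Z := by
      obtain ⟨x, hx⟩ := hne
      simp at hx
      exact hx.1 ▸ hx.2
    rw [Finset.inter_eq_left.mpr (by simpa using this)]
    exact Dec.leaf y
  | node A B hd hA hB h1 h2 ih1 ih2 =>
    have hAX := Finset.subset_union_left.trans hT
    have hBX := Finset.subset_union_right.trans hT
    rw [Finset.union_inter_distrib_right] at hne ⊢
    by_cases e1 : (A ∩ Z).Nonempty
    · by_cases e2 : (B ∩ Z).Nonempty
      · exact Dec.node _ _ (hd.mono Finset.inter_subset_left Finset.inter_subset_left)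
          (ih1 hAX e1) (ih2 hBX e2) (hs.lowRank hAX h1) (hs.lowRank hBX h2)
      · rw [Finset.not_nonempty_iff_eq_empty.mp e2, Finset.union_empty]
        exact ih1 hAX e1
    · rw [Finset.not_nonempty_iff_eq_empty.mp e1, Finset.empty_union] at hne ⊢
      exact ih2 hBX hne

theorem dec_of_tree {G : SimpleGraph V} {k : ℕ} (t : RWTree V) (hn : t.leaves.Nodup)
    (h : ∀ s ∈ t.subtrees, cutRank G s.leaves.toFinset ≤ k) :
    Dec G k t.leaves.toFinset ∧ LowRank G k t.leaves.toFinset := by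
  induction t with
  | leaf v => exact ⟨by simpa [RWTree.leaves] using Dec.leaf v,
      lowRank_of_cutRank (h _ (by simp [RWTree.subtrees]))⟩
  | node l r ihl ihr =>
    refine ⟨?_, lowRank_of_cutRank (h _ (by simp [RWTree.subtrees]))⟩
    simp only [RWTree.leaves] at hn ⊢
    rw [Multiset.nodup_add] at hn
    obtain ⟨a1, a2⟩ := ihl hn.1 (fun s hs => h s (by simp [RWTree.subtrees, hs]))
    obtain ⟨b1, b2⟩ := ihr hn.2.1 (fun s hs => h s (by simp [RWTree.subtrees, hs]))
    rw [Multiset.toFinset_add]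
    exact Dec.node _ _ (Multiset.disjoint_toFinset.mpr hn.2.2) a1 b1 a2 b2

theorem SP_univ (G : SimpleGraph V) (k : ℕ) : SP G k Finset.univ ∅ ∅ := by
  refine ⟨by simp, by simp, ?_, by simp, by simp, ?_, by simp⟩
  · intro x _
    have : rowv G Finset.univ x = 0 := by
      funext w
      simp [rowv]
    rw [this]
    exact Submodule.zero_mem _
  · intro x hx
    simp at hx

end LinAlg

section Combi
set_option linter.unusedSectionVars false
set_option linter.unusedSimpArgs false
open Relation

def cl {U : Type} (r : U → U → Prop) (I : Set U) : Set U := {y | ∃ x ∈ I, ReflTransGen r x y}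

theorem cl_step {U : Type} {r : U → U → Prop} {I : Set U} {x y : U} (hx : x ∈ cl r I) (h : r x y) :
    y ∈ cl r I := by
  obtain ⟨z, hz, hzx⟩ := hx
  exact ⟨z, hz, hzx.tail h⟩

theorem sub_cl {U : Type} {r : U → U → Prop} {I : Set U} {x : U} (hx : x ∈ I) : x ∈ cl r I :=
  ⟨x, hx, ReflTransGen.refl⟩

theorem cl_ind {U : Type} {r : U → U → Prop} {I : Set U} (p : U → Prop) (h0 : ∀ x ∈ I, p x)
    (h1 : ∀ x y, x ∈ cl r I → p x → r x y → p y) {y : U} (hy : y ∈ cl r I) : p y := by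
  obtain ⟨x, hx, h⟩ := hy
  induction h with
  | refl => exact h0 x hx
  | tail h2 h3 ih => exact h1 _ _ ⟨x, hx, h2⟩ ih h3

variable {U Q : Type}

structure Par (Q : Type) where
  P : Finset Q
  g : (Set Q × Set Q) → (Set Q × Set Q) → Prop
  Γ : Set ((Set Q × Set Q) × ((Set Q × Set Q) → ℕ))

def tp (K : SimpleGraph U) (pr : Q → U) (P : Finset Q) (x : U) : Set Q × Set Q :=
  ({p | p ∈ P ∧ x = pr p}, {p | p ∈ P ∧ K.Adj x (pr p)})

noncomputable def col (K : SimpleGraph U) (pr : Q → U) (P : Finset Q) (x : U) :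
    (Set Q × Set Q) × ((Set Q × Set Q) → ℕ) :=
  (tp K pr P x, fun t => Nat.card {y // K.Adj x y ∧ tp K pr P y = t})

def RR (K : SimpleGraph U) (pr : Q → U) (a : Par Q) (x y : U) : Prop :=
  ¬ (K.Adj x y ↔ a.g (tp K pr a.P x) (tp K pr a.P y))

def ZZ (K : SimpleGraph U) (pr : Q → U) (a : Par Q) (J : Set U) : Set U :=
  cl (RR K pr a) ({x | col K pr a.P x ∈ a.Γ} ∪ J)

theorem tp_eq_iff {U' : Type} {K : SimpleGraph U} {pr : Q → U} {K' : SimpleGraph U'} {pr' : Q → U'}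
    {P : Finset Q} {x : U} {x' : U'} : tp K pr P x = tp K' pr' P x' ↔
    ∀ p ∈ P, (x = pr p ↔ x' = pr' p) ∧ (K.Adj x (pr p) ↔ K'.Adj x' (pr' p)) := by
  unfold tp
  rw [Prod.ext_iff]
  simp only [Set.ext_iff, Set.mem_ofPred_eq]
  constructor
  · rintro ⟨h1, h2⟩ p hp
    have h1 := h1 p
    have h2 := h2 p
    simp only [hp, true_and] at h1 h2
    exact ⟨h1, h2⟩
  · intro h
    constructor <;> intro p <;> by_cases hp : p ∈ P <;> simp only [hp, true_and, false_and]
    · exact (h p hp).1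
    · exact (h p hp).2

theorem tp_mono {U' : Type} {K : SimpleGraph U} {pr : Q → U} {K' : SimpleGraph U'} {pr' : Q → U'}
    {P P' : Finset Q} (hP : P ⊆ P') {x : U} {x' : U'} (h : tp K pr P' x = tp K' pr' P' x') :
    tp K pr P x = tp K' pr' P x' := by
  rw [tp_eq_iff] at h ⊢
  exact fun p hp => h p (hP hp)

theorem ZZ_empty_sub {K : SimpleGraph U} {pr : Q → U} {a : Par Q} {J : Set U} {x : U}
    (h : x ∈ ZZ K pr a ∅) : x ∈ ZZ K pr a J := by
  refine cl_ind (fun x => x ∈ ZZ K pr a J) ?_ ?_ h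
  · rintro x (hx | hx)
    · exact sub_cl (Or.inl hx)
    · exact absurd hx (Set.notMem_empty x)
  · intro x y _ hx hr
    exact cl_step hx hr

theorem ZZ_eq_of_mem {K : SimpleGraph U} {pr : Q → U} {a : Par Q} {x y : U}
    (h : x ∈ ZZ K pr a ∅) : y ∈ ZZ K pr a {x} ↔ y ∈ ZZ K pr a ∅ := by
  refine ⟨fun hy => ?_, ZZ_empty_sub⟩
  refine cl_ind (fun x => x ∈ ZZ K pr a ∅) ?_ ?_ hy
  · rintro z (hz | hz)
    · exact sub_cl (Or.inl hz)
    · rw [Set.mem_singleton_iff] at hz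
      rw [hz]; exact h
  · intro x y _ hx hr
    exact cl_step hx hr

theorem self_mem_ZZ {K : SimpleGraph U} {pr : Q → U} {a : Par Q} {x : U} : x ∈ ZZ K pr a {x} :=
  sub_cl (Or.inr rfl)

structure Loc (K : SimpleGraph U) (pr : Q → U) (a : Par Q) (Y : Set U) : Prop where
  det : ∀ u ∈ Y, ∀ w, w ∉ Y → (K.Adj u w ↔ a.g (tp K pr a.P u) (tp K pr a.P w))
  gex : ∀ s t, a.g s t → ∃ w, w ∉ Y ∧ tp K pr a.P w = t
  gam : ∀ x, col K pr a.P x ∈ a.Γ ↔ ∀ y, y ∉ Y → col K pr a.P y ≠ col K pr a.P x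

namespace Loc
variable {K : SimpleGraph U} {pr : Q → U} {a : Par Q} {Y : Set U}

theorem closed (h : Loc K pr a Y) {x y : U} (hx : x ∈ Y) (hr : RR K pr a x y) : y ∈ Y := by
  by_contra hy
  exact hr (h.det x hx y hy)

theorem I0_sub (h : Loc K pr a Y) {x : U} (hx : col K pr a.P x ∈ a.Γ) : x ∈ Y := by
  by_contra hy
  exact (h.gam x).mp hx x hy rfl

theorem Z_sub (h : Loc K pr a Y) {J : Set U} (hJ : J ⊆ Y) : ZZ K pr a J ⊆ Y := by
  intro x hx
  refine cl_ind (fun x => x ∈ Y) ?_ ?_ hx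
  · rintro z (hz | hz)
    · exact h.I0_sub hz
    · exact hJ hz
  · intro x y _ hx hr
    exact h.closed hx hr

theorem C_sub (h : Loc K pr a Y) : ZZ K pr a ∅ ⊆ Y := h.Z_sub (Set.empty_subset _)

theorem exists_twin (h : Loc K pr a Y) {x : U} (hx : x ∉ ZZ K pr a ∅) :
    ∃ y, y ∉ Y ∧ col K pr a.P y = col K pr a.P x := by
  have : ¬ col K pr a.P x ∈ a.Γ := fun hh => hx (sub_cl (Or.inl hh))
  rw [h.gam] at this
  push Not at this
  exact this

theorem sym_aux [Finite U] (h : Loc K pr a Y) {u w u' w' : U} (hu : u ∈ Y) (hw : w ∈ Y)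
    (hu' : u' ∉ Y) (hw' : w' ∉ Y) (eu : col K pr a.P u' = col K pr a.P u)
    (ew : col K pr a.P w' = col K pr a.P w)
    (h1 : ¬ a.g (tp K pr a.P u) (tp K pr a.P w)) (h2 : a.g (tp K pr a.P w) (tp K pr a.P u)) :
    False := by
  set c := tp K pr a.P u with hc
  set d := tp K pr a.P w with hd
  have tu : tp K pr a.P u' = c := congrArg Prod.fst eu
  have tw : tp K pr a.P w' = d := congrArg Prod.fst ew
  have nu : Nat.card {y // K.Adj u' y ∧ tp K pr a.P y = d} =
      Nat.card {y // K.Adj u y ∧ tp K pr a.P y = d} := congrFun (congrArg Prod.snd eu) d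
  have nw : Nat.card {y // K.Adj w' y ∧ tp K pr a.P y = c} =
      Nat.card {y // K.Adj w y ∧ tp K pr a.P y = c} := congrFun (congrArg Prod.snd ew) c
  change Set.ncard {y | K.Adj u' y ∧ tp K pr a.P y = d} =
    Set.ncard {y | K.Adj u y ∧ tp K pr a.P y = d} at nu
  change Set.ncard {y | K.Adj w' y ∧ tp K pr a.P y = c} =
    Set.ncard {y | K.Adj w y ∧ tp K pr a.P y = c} at nw
  have s1 : {y | K.Adj u y ∧ tp K pr a.P y = d} ⊆ {y | y ∈ Y ∧ tp K pr a.P y = d} := by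
    rintro y ⟨hy1, hy2⟩
    refine ⟨?_, hy2⟩
    by_contra hy
    rw [h.det u hu y hy, hy2] at hy1
    exact h1 hy1
  have s2 : {y | y ∈ Y ∧ tp K pr a.P y = d} ⊆ {y | K.Adj u' y ∧ tp K pr a.P y = d} := by
    rintro y ⟨hy1, hy2⟩
    refine ⟨?_, hy2⟩
    rw [K.adj_comm, h.det y hy1 u' hu', hy2, tu]
    exact h2
  have s3 : {y | K.Adj u y ∧ tp K pr a.P y = d} = {y | y ∈ Y ∧ tp K pr a.P y = d} := by
    refine Set.eq_of_subset_of_ncard_le s1 ?_ (Set.toFinite _)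
    rw [← nu]
    exact Set.ncard_le_ncard s2 (Set.toFinite _)
  have huw : K.Adj u w := by
    have : w ∈ {y | K.Adj u y ∧ tp K pr a.P y = d} := by rw [s3]; exact ⟨hw, rfl⟩
    exact this.1
  have s4 : {y | K.Adj w' y ∧ tp K pr a.P y = c} ⊆ {y | K.Adj w y ∧ tp K pr a.P y = c} := by
    rintro y ⟨hy1, hy2⟩
    refine ⟨?_, hy2⟩
    have hy : y ∉ Y := by
      intro hy
      rw [K.adj_comm, h.det y hy w' hw', hy2, tw] at hy1
      exact h1 hy1
    rw [h.det w hw y hy, hy2]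
    exact h2
  have s5 := Set.eq_of_subset_of_ncard_le s4 nw.ge (Set.toFinite _)
  have : u ∈ {y | K.Adj w' y ∧ tp K pr a.P y = c} := by rw [s5]; exact ⟨huw.symm, rfl⟩
  have h3 := this.1
  rw [K.adj_comm, h.det u hu w' hw', tw] at h3
  exact h1 h3

theorem g_symm [Finite U] (h : Loc K pr a Y) {u w : U} (hu : u ∈ Y) (hw : w ∈ Y)
    (hu' : u ∉ ZZ K pr a ∅) (hw' : w ∉ ZZ K pr a ∅) :
    a.g (tp K pr a.P u) (tp K pr a.P w) ↔ a.g (tp K pr a.P w) (tp K pr a.P u) := by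
  obtain ⟨u', h1, h2⟩ := h.exists_twin hu'
  obtain ⟨w', h3, h4⟩ := h.exists_twin hw'
  constructor
  · intro h5
    by_contra h6
    exact h.sym_aux hw hu h3 h1 h4 h2 h6 h5
  · intro h5
    by_contra h6
    exact h.sym_aux hu hw h1 h3 h2 h4 h6 h5

theorem RR_symm [Finite U] (h : Loc K pr a Y) {u w : U} (hu : u ∈ Y) (hw : w ∈ Y)
    (hu' : u ∉ ZZ K pr a ∅) (hw' : w ∉ ZZ K pr a ∅) (hr : RR K pr a u w) : RR K pr a w u := by
  unfold RR at hr ⊢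
  rw [K.adj_comm, ← h.g_symm hu hw hu' hw']
  exact hr

end Loc

structure RPar (Q : Type) where
  P : Finset Q
  pa : Bool → Par Q
  Θ : Bool → Set (Set Q × Set Q)

def Cc (K : SimpleGraph U) (pr : Q → U) (pa : Bool → Par Q) (i : Bool) : Set U :=
  ZZ K pr (pa i) ∅

def Rest (K : SimpleGraph U) (pr : Q → U) (pa : Bool → Par Q) (Y : Set U) : Set U :=
  {x | x ∈ Y ∧ ∀ i, x ∉ Cc K pr pa i}

def UU (K : SimpleGraph U) (pr : Q → U) (R : RPar Q) (Y : Set U) (i : Bool) : Set U :=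
  cl (fun x y => RR K pr (R.pa i) x y ∧ y ∈ Rest K pr R.pa Y)
    {x | x ∈ Rest K pr R.pa Y ∧ tp K pr R.P x ∉ R.Θ (!i)}

def U0 (K : SimpleGraph U) (pr : Q → U) (R : RPar Q) (Y : Set U) : Set U :=
  {x | x ∈ Rest K pr R.pa Y ∧ ∀ i, x ∉ UU K pr R Y i}

def FF (K : SimpleGraph U) (pr : Q → U) (R : RPar Q) (Y : Set U) (x y : U) : Prop :=
  (x ∉ Y ∧ y ∉ Y) ∨ (∃ i, x ∈ Cc K pr R.pa i ∧ y ∈ Cc K pr R.pa i) ∨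
  (∃ i, x ∈ UU K pr R Y i ∧ y ∈ UU K pr R Y i ∧ (RR K pr (R.pa i) x y ∨ RR K pr (R.pa i) y x)) ∨
  (x ∈ U0 K pr R Y ∧ y ∈ U0 K pr R Y ∧ ∃ i, (RR K pr (R.pa i) x y ∨ RR K pr (R.pa i) y x))

def EE (K : SimpleGraph U) (pr : Q → U) (R : RPar Q) (Y : Set U) (x y : U) : Prop :=
  ReflTransGen (FF K pr R Y) x y

theorem FF_symm {K : SimpleGraph U} {pr : Q → U} {R : RPar Q} {Y : Set U} {x y : U}
    (h : FF K pr R Y x y) : FF K pr R Y y x := by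
  rcases h with h | ⟨i, h1, h2⟩ | ⟨i, h1, h2, h3⟩ | ⟨h1, h2, i, h3⟩
  · exact Or.inl ⟨h.2, h.1⟩
  · exact Or.inr (Or.inl ⟨i, h2, h1⟩)
  · exact Or.inr (Or.inr (Or.inl ⟨i, h2, h1, h3.symm⟩))
  · exact Or.inr (Or.inr (Or.inr ⟨h2, h1, i, h3.symm⟩))

theorem EE_equiv (K : SimpleGraph U) (pr : Q → U) (R : RPar Q) (Y : Set U) :
    Equivalence (EE K pr R Y) where
  refl _ := ReflTransGen.refl
  symm {x y} h := by
    induction h with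
    | refl => exact ReflTransGen.refl
    | tail _ h2 ih => exact ReflTransGen.head (FF_symm h2) ih
  trans h1 h2 := ReflTransGen.trans h1 h2

structure Glob (K : SimpleGraph U) (pr : Q → U) (R : RPar Q) (Y : Set U) (Ys : Bool → Set U) :
    Prop where
  loc : ∀ i, Loc K pr (R.pa i) (Ys i)
  cov : ∀ x, x ∈ Y ↔ ∃ i, x ∈ Ys i
  disj : ∀ x i j, x ∈ Ys i → x ∈ Ys j → i = j
  sub : ∀ i, (R.pa i).P ⊆ R.P
  th : ∀ t j, t ∈ R.Θ j ↔ ∃ y, y ∈ Rest K pr R.pa Y ∧ y ∈ Ys j ∧ tp K pr R.P y = t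

namespace Glob
variable {K : SimpleGraph U} {pr : Q → U} {R : RPar Q} {Y : Set U} {Ys : Bool → Set U}

theorem C_sub (h : Glob K pr R Y Ys) {x : U} {i : Bool} (hx : x ∈ Cc K pr R.pa i) : x ∈ Ys i :=
  (h.loc i).C_sub hx

theorem mem_Rest (h : Glob K pr R Y Ys) {x : U} {i : Bool} (hx : x ∈ Ys i)
    (hc : x ∉ Cc K pr R.pa i) : x ∈ Rest K pr R.pa Y := by
  refine ⟨(h.cov x).mpr ⟨i, hx⟩, fun j hj => ?_⟩
  have := h.disj x i j hx (h.C_sub hj)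
  subst this
  exact hc hj

theorem UU_sub (h : Glob K pr R Y Ys) {x : U} {i : Bool} (hx : x ∈ UU K pr R Y i) :
    x ∈ Ys i ∧ x ∈ Rest K pr R.pa Y := by
  refine cl_ind (fun x => x ∈ Ys i ∧ x ∈ Rest K pr R.pa Y) ?_ ?_ hx
  · rintro z ⟨h1, h2⟩
    refine ⟨?_, h1⟩
    obtain ⟨j, hj⟩ := (h.cov z).mp h1.1
    by_cases hij : j = i
    · rw [← hij]; exact hj
    · have : j = !i := by cases i <;> cases j <;> simp at hij ⊢
      subst this
      exact absurd ((h.th _ _).mpr ⟨z, h1, hj, rfl⟩) h2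
  · rintro z w _ h1 h2
    exact ⟨(h.loc i).closed h1.1 h2.1, h2.2⟩

theorem U0_occ (h : Glob K pr R Y Ys) {x : U} (hx : x ∈ U0 K pr R Y) (i : Bool) :
    ∃ y, y ∈ Rest K pr R.pa Y ∧ y ∈ Ys i ∧ tp K pr R.P y = tp K pr R.P x := by
  rw [← h.th]
  by_contra hc
  refine hx.2 (!i) (sub_cl ⟨hx.1, ?_⟩)
  rw [Bool.not_not]
  exact hc

theorem U0_g [Finite U] (h : Glob K pr R Y Ys) {x y : U} (hx : x ∈ U0 K pr R Y)
    (hy : y ∈ U0 K pr R Y) (i j : Bool) :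
    ((R.pa i).g (tp K pr (R.pa i).P x) (tp K pr (R.pa i).P y) ↔
      (R.pa j).g (tp K pr (R.pa j).P x) (tp K pr (R.pa j).P y)) ∧
    ((R.pa i).g (tp K pr (R.pa i).P x) (tp K pr (R.pa i).P y) ↔
      (R.pa i).g (tp K pr (R.pa i).P y) (tp K pr (R.pa i).P x)) := by
  have sy : ∀ i, ((R.pa i).g (tp K pr (R.pa i).P x) (tp K pr (R.pa i).P y) ↔
      (R.pa i).g (tp K pr (R.pa i).P y) (tp K pr (R.pa i).P x)) := by
    intro i
    obtain ⟨u, hu1, hu2, hu3⟩ := h.U0_occ hx i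
    obtain ⟨w, hw1, hw2, hw3⟩ := h.U0_occ hy i
    have := (h.loc i).g_symm hu2 hw2 (hu1.2 i) (hw1.2 i)
    rw [tp_mono (h.sub i) hu3, tp_mono (h.sub i) hw3] at this
    exact this
  have cr : ((R.pa true).g (tp K pr (R.pa true).P x) (tp K pr (R.pa true).P y) ↔
      (R.pa false).g (tp K pr (R.pa false).P y) (tp K pr (R.pa false).P x)) := by
    obtain ⟨u, hu1, hu2, hu3⟩ := h.U0_occ hx true
    obtain ⟨w, hw1, hw2, hw3⟩ := h.U0_occ hy false
    have hu4 : u ∉ Ys false := fun hh => by simpa using h.disj _ _ _ hu2 hh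
    have hw4 : w ∉ Ys true := fun hh => by simpa using h.disj _ _ _ hw2 hh
    have e1 := (h.loc true).det u hu2 w hw4
    have e2 := (h.loc false).det w hw2 u hu4
    rw [tp_mono (h.sub _) hu3, tp_mono (h.sub _) hw3] at e1 e2
    rw [← e1, ← e2, K.adj_comm]
  refine ⟨?_, sy i⟩
  have cr2 := cr.trans (sy false).symm
  cases i <;> cases j
  · exact Iff.rfl
  · exact cr2.symm
  · exact cr2
  · exact Iff.rfl

theorem U0_RR [Finite U] (h : Glob K pr R Y Ys) {x y : U} (hx : x ∈ U0 K pr R Y)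
    (hy : y ∈ U0 K pr R Y) {j : Bool} (i : Bool)
    (hr : RR K pr (R.pa j) x y ∨ RR K pr (R.pa j) y x) : RR K pr (R.pa i) x y := by
  unfold RR at hr ⊢
  rw [(h.U0_g hx hy i j).1]
  rcases hr with hr | hr
  · exact hr
  · rwa [K.adj_comm, ← (h.U0_g hx hy j j).2] at hr

theorem E_notMem (h : Glob K pr R Y Ys) {x y : U} (he : EE K pr R Y x y) (hx : x ∉ Y) : y ∉ Y := by
  induction he with
  | refl => exact hx
  | tail _ hf ih =>
    rcases hf with hf | ⟨i, h1, h2⟩ | ⟨i, h1, h2, h3⟩ | ⟨h1, h2, i, h3⟩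
    · exact hf.2
    · exact absurd ((h.cov _).mpr ⟨i, h.C_sub h1⟩) ih
    · exact absurd (h.UU_sub h1).2.1 ih
    · exact absurd h1.1.1 ih

theorem E_Y (h : Glob K pr R Y Ys) {x y : U} (he : EE K pr R Y x y) : x ∈ Y ↔ y ∈ Y := by
  constructor
  · intro hx
    by_contra hy
    exact h.E_notMem ((EE_equiv K pr R Y).symm he) hy hx
  · intro hy
    by_contra hx
    exact h.E_notMem he hx hy

theorem E_out_iff (h : Glob K pr R Y Ys) {x y : U} (hx : x ∉ Y) : EE K pr R Y x y ↔ y ∉ Y :=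
  ⟨fun he => h.E_notMem he hx, fun hy => ReflTransGen.single (Or.inl ⟨hx, hy⟩)⟩

theorem E_C' (h : Glob K pr R Y Ys) {x y : U} {i : Bool} (he : EE K pr R Y x y)
    (hx : x ∈ Cc K pr R.pa i) : y ∈ Cc K pr R.pa i := by
  induction he with
  | refl => exact hx
  | tail _ hf ih =>
    rcases hf with hf | ⟨j, h1, h2⟩ | ⟨j, h1, h2, h3⟩ | ⟨h1, h2, j, h3⟩
    · exact absurd ((h.cov _).mpr ⟨i, h.C_sub ih⟩) hf.1
    · have := h.disj _ _ _ (h.C_sub ih) (h.C_sub h1)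
      subst this
      exact h2
    · exact absurd ih ((h.UU_sub h1).2.2 i)
    · exact absurd ih (h1.1.2 i)

theorem E_C (h : Glob K pr R Y Ys) {x y : U} {i : Bool} (he : EE K pr R Y x y) :
    x ∈ Cc K pr R.pa i ↔ y ∈ Cc K pr R.pa i :=
  ⟨h.E_C' he, h.E_C' ((EE_equiv K pr R Y).symm he)⟩

theorem E_iff [Finite U] (h : Glob K pr R Y Ys) {x y : U} {i : Bool} (hx : x ∈ Ys i) :
    EE K pr R Y x y ↔ y ∈ ZZ K pr (R.pa i) {x} ∧ (x ∈ Cc K pr R.pa i ∨ y ∉ Cc K pr R.pa i) := by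
  by_cases hc : x ∈ Cc K pr R.pa i
  · rw [ZZ_eq_of_mem hc]
    constructor
    · intro he
      exact ⟨h.E_C' he hc, Or.inl hc⟩
    · rintro ⟨h1, _⟩
      exact ReflTransGen.single (Or.inr (Or.inl ⟨i, hc, h1⟩))
  · constructor
    · intro he
      refine ⟨?_, Or.inr (by rwa [← h.E_C he])⟩
      have : y ∈ ZZ K pr (R.pa i) {x} ∧ y ∈ Ys i := by
        induction he with
        | refl => exact ⟨self_mem_ZZ, hx⟩
        | @tail y z he hf ih =>
          have hyC : y ∉ Cc K pr R.pa i := by rwa [← h.E_C he]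
          have hzC : z ∉ Cc K pr R.pa i := by
            rwa [← h.E_C (ReflTransGen.tail he hf)]
          suffices hr : RR K pr (R.pa i) y z from
            ⟨cl_step ih.1 hr, (h.loc i).closed ih.2 hr⟩
          rcases hf with hf | ⟨j, h1, h2⟩ | ⟨j, h1, h2, h3⟩ | ⟨h1, h2, j, h3⟩
          · exact absurd ((h.cov _).mpr ⟨i, ih.2⟩) hf.1
          · have := h.disj _ _ _ ih.2 (h.C_sub h1)
            subst this
            exact absurd h1 hyC
          · have := h.disj _ _ _ ih.2 (h.UU_sub h1).1
            subst this
            rcases h3 with h3 | h3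
            · exact h3
            · exact (h.loc i).RR_symm (h.UU_sub h2).1 ih.2 hzC hyC h3
          · exact h.U0_RR h1 h2 i h3
      exact this.1
    · rintro ⟨h1, h2⟩
      have h2 := h2.resolve_left hc
      have key : ∀ y, y ∈ ZZ K pr (R.pa i) {x} → y ∈ Ys i ∧ (y ∉ Cc K pr R.pa i → EE K pr R Y x y) := by
        intro y hy
        refine cl_ind (fun y => y ∈ Ys i ∧ (y ∉ Cc K pr R.pa i → EE K pr R Y x y)) ?_ ?_ hy
        · rintro z (hz | hz)
          · exact ⟨(h.loc i).I0_sub hz, fun hh => absurd (show z ∈ Cc K pr R.pa i from sub_cl (Or.inl hz)) hh⟩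
          · rw [Set.mem_singleton_iff] at hz
            subst hz
            exact ⟨hx, fun _ => ReflTransGen.refl⟩
        · rintro z w _ ⟨hz1, hz2⟩ hr
          have hw1 := (h.loc i).closed hz1 hr
          refine ⟨hw1, fun hwC => ?_⟩
          have hzC : z ∉ Cc K pr R.pa i := fun hh => hwC (cl_step hh hr)
          refine ReflTransGen.tail (hz2 hzC) ?_
          have hr2 := (h.loc i).RR_symm hz1 hw1 hzC hwC hr
          have hzR := h.mem_Rest hz1 hzC
          have hwR := h.mem_Rest hw1 hwC
          by_cases hzU : z ∈ UU K pr R Y i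
          · exact Or.inr (Or.inr (Or.inl ⟨i, hzU, cl_step hzU ⟨hr, hwR⟩, Or.inl hr⟩))
          · have hwU : w ∉ UU K pr R Y i := fun hh => hzU (cl_step hh ⟨hr2, hzR⟩)
            refine Or.inr (Or.inr (Or.inr ⟨⟨hzR, ?_⟩, ⟨hwR, ?_⟩, i, Or.inl hr⟩))
            · intro j hj
              have := h.disj _ _ _ hz1 (h.UU_sub hj).1
              subst this
              exact hzU hj
            · intro j hj
              have := h.disj _ _ _ hw1 (h.UU_sub hj).1
              subst this
              exact hwU hj
      exact (key y h1).2 h2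

end Glob
end Combi

section Assembly
set_option linter.unusedSectionVars false

open Classical in
theorem sum_class {V : Type} [Fintype V] (E : Setoid V) (A : Finset (Quotient E)) :
    ∑ x ∈ Finset.univ.filter (fun x : V => (Quotient.mk E x) ∈ A),
      (1 / (Nat.card {y // E.r x y} : ℚ)) = A.card := by
  rw [← Finset.sum_fiberwise_of_maps_to (s := Finset.univ.filter (fun x : V => (Quotient.mk E x) ∈ A))
    (t := A) (g := fun x => Quotient.mk E x) (fun x hx => (Finset.mem_filter.mp hx).2)]
  rw [Finset.card_eq_sum_ones, Nat.cast_sum]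
  refine Finset.sum_congr rfl fun a ha => ?_
  obtain ⟨z, rfl⟩ := Quotient.exists_rep a
  have h1 : ((Finset.univ.filter (fun x : V => (Quotient.mk E x) ∈ A)).filter
      (fun x => Quotient.mk E x = Quotient.mk E z)) = Finset.univ.filter (fun y => E.r z y) := by
    ext y
    simp only [Finset.mem_filter, Finset.mem_univ, true_and]
    constructor
    · rintro ⟨_, h⟩
      exact E.symm (Quotient.exact h)
    · intro h
      have : Quotient.mk E y = Quotient.mk E z := Quotient.sound (E.symm h)
      exact ⟨by rw [this]; exact ha, this⟩
  rw [h1]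
  have h2 : ∀ x ∈ Finset.univ.filter (fun y => E.r z y),
      (1 / (Nat.card {y // E.r x y} : ℚ)) = 1 / (Nat.card {y // E.r z y} : ℚ) := by
    intro x hx
    have hx := (Finset.mem_filter.mp hx).2
    have : (fun y => E.r x y) = (fun y => E.r z y) := by
      funext y
      exact propext ⟨fun h => E.trans hx h, fun h => E.trans (E.symm hx) h⟩
    rw [show {y // E.r x y} = {y // E.r z y} from congrArg Subtype this]
  rw [Finset.sum_congr rfl h2, Finset.sum_const, Nat.card_eq_fintype_card, Fintype.card_subtype]
  have : (Finset.univ.filter (fun y => E.r z y)).card ≠ 0 := by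
    rw [Finset.card_ne_zero]
    exact ⟨z, by simp [E.refl z]⟩
  have : ((Finset.univ.filter (fun y => E.r z y)).card : ℚ) ≠ 0 := by exact_mod_cast this
  rw [nsmul_eq_mul]
  field_simp
  simp

open Classical in
theorem assembly {V W : Type} [Fintype V] [Fintype W] (E : Setoid V) (E' : Setoid W) (σ : V ≃ W)
    (Ψ : V → V ≃ W) (h : ∀ x y, E.r x y ↔ E'.r (σ x) (Ψ x y)) :
    ∃ (Φ : V ≃ W) (ρ : V → V), (∀ y, E.r (ρ y) y) ∧ (∀ y z, E.r y z → ρ y = ρ z) ∧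
      (∀ y, Φ y = Ψ (ρ y) y) ∧ (∀ y z, E.r y z ↔ E'.r (Φ y) (Φ z)) ∧
      ∀ y, E'.r (σ (ρ y)) (Φ y) := by
  have hw : ∀ x, Nat.card {y // E.r x y} = Nat.card {y // E'.r (σ x) y} := fun x =>
    Nat.card_congr ((Ψ x).subtypeEquiv (h x))
  let t : Quotient E → Finset (Quotient E') := fun a =>
    (Finset.univ.filter (fun x : V => Quotient.mk E x = a)).image (fun x => Quotient.mk E' (σ x))
  have hall : ∀ A : Finset (Quotient E), A.card ≤ (A.biUnion t).card := by
    intro A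
    have h1 := sum_class E A
    have h2 := sum_class E' (A.biUnion t)
    have : (A.card : ℚ) ≤ (A.biUnion t).card := by
      rw [← h1, ← h2]
      have e : ∑ x ∈ Finset.univ.filter (fun x : V => (Quotient.mk E x) ∈ A),
          (1 / (Nat.card {y // E.r x y} : ℚ)) =
          ∑ x' ∈ (Finset.univ.filter (fun x : V => (Quotient.mk E x) ∈ A)).map σ.toEmbedding,
          (1 / (Nat.card {y // E'.r x' y} : ℚ)) := by
        rw [Finset.sum_map]
        refine Finset.sum_congr rfl fun x _ => ?_
        rw [hw x]; rfl
      rw [e]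
      refine Finset.sum_le_sum_of_subset_of_nonneg ?_ ?_
      · intro x' hx'
        obtain ⟨x, hx, rfl⟩ := Finset.mem_map.mp hx'
        have hx := (Finset.mem_filter.mp hx).2
        refine Finset.mem_filter.mpr ⟨Finset.mem_univ _, ?_⟩
        exact Finset.mem_biUnion.mpr ⟨_, hx, Finset.mem_image.mpr ⟨x, by simp, rfl⟩⟩
      · intros; positivity
    exact_mod_cast this
  obtain ⟨f, hf, hft⟩ := (Finset.all_card_le_biUnion_card_iff_exists_injective t).mp hall
  have hr : ∀ a, ∃ x, Quotient.mk E x = a ∧ Quotient.mk E' (σ x) = f a := by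
    intro a
    obtain ⟨x, hx, hx2⟩ := Finset.mem_image.mp (hft a)
    exact ⟨x, (Finset.mem_filter.mp hx).2, hx2⟩
  choose rep hr1 hr2 using hr
  have hE : ∀ y, E.r (rep (Quotient.mk E y)) y := fun y => Quotient.exact (hr1 (Quotient.mk E y))
  let Φ0 : V → W := fun y => Ψ (rep (Quotient.mk E y)) y
  have hE' : ∀ y, E'.r (σ (rep (Quotient.mk E y))) (Φ0 y) := fun y => (h _ _).mp (hE y)
  have hq : ∀ y, Quotient.mk E' (Φ0 y) = f (Quotient.mk E y) := by
    intro y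
    rw [← hr2]
    exact Quotient.sound (E'.symm (hE' y))
  have inj : Function.Injective Φ0 := by
    intro y z hyz
    have h1 : Quotient.mk E y = Quotient.mk E z := by
      apply hf
      rw [← hq, ← hq, hyz]
    have : Ψ (rep (Quotient.mk E y)) y = Ψ (rep (Quotient.mk E z)) z := hyz
    rw [h1] at this
    exact (Ψ _).injective this
  have bij : Function.Bijective Φ0 :=
    (Fintype.bijective_iff_injective_and_card Φ0).mpr ⟨inj, Fintype.card_congr σ⟩
  refine ⟨Equiv.ofBijective Φ0 bij, fun y => rep (Quotient.mk E y), hE, ?_, fun y => rfl, ?_, hE'⟩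
  · intro y z hyz
    have : Quotient.mk E y = Quotient.mk E z := Quotient.sound hyz
    show rep (Quotient.mk E y) = rep (Quotient.mk E z)
    rw [this]
  · intro y z
    show E.r y z ↔ E'.r (Φ0 y) (Φ0 z)
    constructor
    · intro hyz
      have : Quotient.mk E y = Quotient.mk E z := Quotient.sound hyz
      have h2 : Quotient.mk E' (Φ0 y) = Quotient.mk E' (Φ0 z) := by rw [hq, hq, this]
      exact Quotient.exact h2
    · intro hyz
      have : Quotient.mk E' (Φ0 y) = Quotient.mk E' (Φ0 z) := Quotient.sound hyz
      rw [hq, hq] at this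
      exact Quotient.exact (hf this)

end Assembly

section Invar
set_option linter.unusedSectionVars false
variable {V W : Type} [Fintype V] [DecidableEq V] [Fintype W] [DecidableEq W]
  {G : SimpleGraph V} {H : SimpleGraph W} {N : ℕ} {Good : Finset (V × W) → Prop}

theorem PGame.forth (pg : PGame G H N Good) {S : Finset (V × W)} (hS : Good S) (z : V) :
    ∃ z', ∀ T ⊆ S, T.card < N → Good (insert (z, z') T) := by
  obtain ⟨σ, h⟩ := pg.ext hS
  exact ⟨σ z, h z⟩

theorem PGame.back (pg : PGame G H N Good) {S : Finset (V × W)} (hS : Good S) (z' : W) :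
    ∃ z, ∀ T ⊆ S, T.card < N → Good (insert (z, z') T) := by
  obtain ⟨σ, h⟩ := pg.ext hS
  refine ⟨σ.symm z', ?_⟩
  have := h (σ.symm z')
  rwa [σ.apply_symm_apply] at this

def GInv (Good : Finset (V × W) → Prop) (S : Finset (V × W)) (I : Set V) (I' : Set W) : Prop :=
  ∀ x x', Good (insert (x, x') S) → (x ∈ I ↔ x' ∈ I')

abbrev fs : V × W → V := Prod.fst
abbrev sn : V × W → W := Prod.snd

theorem tp_inv (pg : PGame G H N Good) {P T : Finset (V × W)} (hP : P ⊆ T) (hT : Good T) {x : V}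
    {x' : W} (hx : (x, x') ∈ T) : tp G fs P x = tp H sn P x' := by
  rw [tp_eq_iff]
  intro p hp
  exact ⟨pg.eqv hT _ hx _ (hP hp), pg.adj hT _ hx _ (hP hp)⟩

theorem col_inv (pg : PGame G H N Good) {P S : Finset (V × W)} (hP : P ⊆ S) (hc : S.card + 1 < N)
    {x : V} {x' : W} (hx : Good (insert (x, x') S)) : col G fs P x = col H sn P x' := by
  unfold col
  rw [tp_inv pg (hP.trans (Finset.subset_insert _ _)) hx (Finset.mem_insert_self _ _)]
  congr 1
  funext t
  obtain ⟨σ, h⟩ := pg.ext hx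
  refine Nat.card_congr (σ.subtypeEquiv fun y => ?_)
  have hg := h y _ (Finset.Subset.refl _) (lt_of_le_of_lt (Finset.card_insert_le _ _) hc)
  rw [tp_inv pg (hP.trans ((Finset.subset_insert _ _).trans (Finset.subset_insert _ _))) hg
    (Finset.mem_insert_self _ _)]
  have := pg.adj hg (x, x') (by simp) (y, σ y) (by simp)
  rw [this]

theorem RR_inv (pg : PGame G H N Good) {a : Par (V × W)} {T : Finset (V × W)} (hP : a.P ⊆ T)
    (hT : Good T) {x y : V} {x' y' : W} (hx : (x, x') ∈ T) (hy : (y, y') ∈ T) :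
    RR G fs a x y ↔ RR H sn a x' y' := by
  unfold RR
  rw [tp_inv pg hP hT hx, tp_inv pg hP hT hy, pg.adj hT _ hx _ hy]

theorem cl_inv {r : V → V → Prop} {r' : W → W → Prop} {I : Set V} {I' : Set W}
    (β : V → W → Prop) (hI : ∀ y y', β y y' → (y ∈ I ↔ y' ∈ I'))
    (hf : ∀ y y', β y y' → ∀ z, ∃ z', β z z' ∧ (r z y ↔ r' z' y'))
    (hb : ∀ y y', β y y' → ∀ z', ∃ z, β z z' ∧ (r z y ↔ r' z' y')) {y : V} {y' : W}
    (hy : β y y') : y ∈ cl r I ↔ y' ∈ cl r' I' := by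
  constructor
  · rintro ⟨x, hx, h⟩
    induction h generalizing y' with
    | refl => exact sub_cl ((hI _ _ hy).mp hx)
    | tail _ h2 ih =>
      obtain ⟨z', h3, h4⟩ := hf _ _ hy _
      exact cl_step (ih h3) (h4.mp h2)
  · rintro ⟨x, hx, h⟩
    induction h generalizing y with
    | refl => exact sub_cl ((hI _ _ hy).mpr hx)
    | tail _ h2 ih =>
      obtain ⟨z', h3, h4⟩ := hb _ _ hy _
      exact cl_step (ih h3) (h4.mpr h2)

/-- closure over a fixed set of pebbles -/
theorem cl_inv_game (pg : PGame G H N Good) {S : Finset (V × W)} (hc : S.card + 1 < N)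
    {r : V → V → Prop} {r' : W → W → Prop} {I : Set V} {I' : Set W} (hI : GInv Good S I I')
    (hr : ∀ T, S ⊆ T → Good T → ∀ x x' y y', (x, x') ∈ T → (y, y') ∈ T → (r x y ↔ r' x' y')) :
    GInv Good S (cl r I) (cl r' I') := by
  intro y y' hy
  have hlt : ∀ p : V × W, (insert p S).card < N := fun p =>
    lt_of_le_of_lt (Finset.card_insert_le _ _) hc
  have hs : ∀ p q : V × W, insert p S ⊆ insert p (insert q S) := fun p q =>
    Finset.insert_subset_insert _ (Finset.subset_insert _ _)
  refine cl_inv (fun y y' => Good (insert (y, y') S)) hI ?_ ?_ hy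
  · intro y y' hy z
    obtain ⟨z', hz⟩ := pg.forth hy z
    have hg := hz _ (Finset.Subset.refl _) (hlt _)
    exact ⟨z', pg.mono (hs _ _) hg, hr _ ((Finset.subset_insert _ _).trans
      (Finset.subset_insert _ _)) hg _ _ _ _ (by simp) (by simp)⟩
  · intro y y' hy z'
    obtain ⟨z, hz⟩ := pg.back hy z'
    have hg := hz _ (Finset.Subset.refl _) (hlt _)
    exact ⟨z, pg.mono (hs _ _) hg, hr _ ((Finset.subset_insert _ _).trans
      (Finset.subset_insert _ _)) hg _ _ _ _ (by simp) (by simp)⟩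

theorem ZZ_inv (pg : PGame G H N Good) {S : Finset (V × W)} (hc : S.card + 1 < N)
    {a : Par (V × W)} (hP : a.P ⊆ S) {J : Set V} {J' : Set W} (hJ : GInv Good S J J') :
    GInv Good S (ZZ G fs a J) (ZZ H sn a J') := by
  refine cl_inv_game pg hc ?_ ?_
  · intro x x' hx
    simp only [Set.mem_union, Set.mem_ofPred_eq]
    rw [col_inv pg hP hc hx, hJ x x' hx]
  · intro T hT hg x x' y y' hx hy
    exact RR_inv pg (hP.trans hT) hg hx hy

theorem GInv_empty {S : Finset (V × W)} : GInv Good S (∅ : Set V) (∅ : Set W) := by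
  intro x x' _
  simp

theorem GInv.mem {S T : Finset (V × W)} {I : Set V} {I' : Set W} (h : GInv Good S I I')
    (pg : PGame G H N Good) (hST : S ⊆ T) (hT : Good T) {x : V} {x' : W} (hx : (x, x') ∈ T) :
    x ∈ I ↔ x' ∈ I' :=
  h x x' (pg.mono (Finset.insert_subset hx hST) hT)

theorem Cc_inv (pg : PGame G H N Good) {S : Finset (V × W)} (hc : S.card + 1 < N)
    {R : RPar (V × W)} (hP : ∀ i, (R.pa i).P ⊆ S) (i : Bool) :
    GInv Good S (Cc G fs R.pa i) (Cc H sn R.pa i) := ZZ_inv pg hc (hP i) GInv_empty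

theorem Rest_inv (pg : PGame G H N Good) {S : Finset (V × W)} (hc : S.card + 1 < N)
    {R : RPar (V × W)} (hP : ∀ i, (R.pa i).P ⊆ S) {Y : Set V} {Y' : Set W} (hY : GInv Good S Y Y') :
    GInv Good S (Rest G fs R.pa Y) (Rest H sn R.pa Y') := by
  intro x x' hx
  unfold Rest
  simp only [Set.mem_ofPred_eq]
  rw [hY x x' hx]
  have := fun i => Cc_inv pg hc hP i x x' hx
  simp only [this]

theorem UU_inv (pg : PGame G H N Good) {S : Finset (V × W)} (hc : S.card + 1 < N)
    {R : RPar (V × W)} (hP : ∀ i, (R.pa i).P ⊆ S) (hRP : R.P ⊆ S) {Y : Set V} {Y' : Set W}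
    (hY : GInv Good S Y Y') (i : Bool) :
    GInv Good S (UU G fs R Y i) (UU H sn R Y' i) := by
  have hR := Rest_inv pg hc hP hY
  refine cl_inv_game pg hc ?_ ?_
  · intro x x' hx
    simp only [Set.mem_ofPred_eq]
    rw [hR x x' hx, tp_inv pg (hRP.trans (Finset.subset_insert _ _)) hx (Finset.mem_insert_self _ _)]
  · intro T hT hg x x' y y' hx hy
    rw [RR_inv pg ((hP i).trans hT) hg hx hy, hR.mem pg hT hg hy]

theorem U0_inv (pg : PGame G H N Good) {S : Finset (V × W)} (hc : S.card + 1 < N)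
    {R : RPar (V × W)} (hP : ∀ i, (R.pa i).P ⊆ S) (hRP : R.P ⊆ S) {Y : Set V} {Y' : Set W}
    (hY : GInv Good S Y Y') :
    GInv Good S (U0 G fs R Y) (U0 H sn R Y') := by
  intro x x' hx
  unfold U0
  simp only [Set.mem_ofPred_eq]
  rw [Rest_inv pg hc hP hY x x' hx]
  have := fun i => UU_inv pg hc hP hRP hY i x x' hx
  simp only [this]

theorem FF_inv (pg : PGame G H N Good) {S : Finset (V × W)} (hc : S.card + 1 < N)
    {R : RPar (V × W)} (hP : ∀ i, (R.pa i).P ⊆ S) (hRP : R.P ⊆ S) {Y : Set V} {Y' : Set W}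
    (hY : GInv Good S Y Y') {T : Finset (V × W)} (hT : S ⊆ T) (hg : Good T) {x y : V} {x' y' : W}
    (hx : (x, x') ∈ T) (hy : (y, y') ∈ T) : FF G fs R Y x y ↔ FF H sn R Y' x' y' := by
  unfold FF
  have h1 := fun i => (Cc_inv pg hc hP i).mem pg hT hg hx
  have h2 := fun i => (Cc_inv pg hc hP i).mem pg hT hg hy
  have h3 := fun i => (UU_inv pg hc hP hRP hY i).mem pg hT hg hx
  have h4 := fun i => (UU_inv pg hc hP hRP hY i).mem pg hT hg hy
  have h5 := fun i => RR_inv pg ((hP i).trans hT) hg hx hy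
  have h6 := fun i => RR_inv pg ((hP i).trans hT) hg hy hx
  simp only [hY.mem pg hT hg hx, hY.mem pg hT hg hy, (U0_inv pg hc hP hRP hY).mem pg hT hg hx,
    (U0_inv pg hc hP hRP hY).mem pg hT hg hy, h1, h2, h3, h4, h5, h6]

theorem EE_inv (pg : PGame G H N Good) {S : Finset (V × W)} (hc : S.card + 1 < N)
    {R : RPar (V × W)} (hP : ∀ i, (R.pa i).P ⊆ S) (hRP : R.P ⊆ S) {Y : Set V} {Y' : Set W}
    (hY : GInv Good S Y Y') {x y : V} {x' y' : W}
    (hg : Good (insert (y, y') (insert (x, x') S))) : EE G fs R Y x y ↔ EE H sn R Y' x' y' := by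
  have key : y ∈ cl (FF G fs R Y) {x} ↔ y' ∈ cl (FF H sn R Y') {x'} := by
    have hlt : ∀ p : V × W, (insert p S).card < N := fun p =>
      lt_of_le_of_lt (Finset.card_insert_le _ _) hc
    refine cl_inv (fun y y' => Good (insert (y, y') (insert (x, x') S))) ?_ ?_ ?_ hg
    · intro y y' hy
      exact pg.eqv hy (y, y') (by simp) (x, x') (by simp)
    · intro y y' hy z
      obtain ⟨z', hz⟩ := pg.forth hy z
      refine ⟨z', hz _ (Finset.subset_insert _ _) (hlt _), ?_⟩
      have hg := hz (insert (y, y') S)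
        (Finset.insert_subset_insert _ (Finset.subset_insert _ _)) (hlt _)
      exact FF_inv pg hc hP hRP hY ((Finset.subset_insert _ _).trans
        (Finset.subset_insert _ _)) hg (by simp) (by simp)
    · intro y y' hy z'
      obtain ⟨z, hz⟩ := pg.back hy z'
      refine ⟨z, hz _ (Finset.subset_insert _ _) (hlt _), ?_⟩
      have hg := hz (insert (y, y') S)
        (Finset.insert_subset_insert _ (Finset.subset_insert _ _)) (hlt _)
      exact FF_inv pg hc hP hRP hY ((Finset.subset_insert _ _).trans
        (Finset.subset_insert _ _)) hg (by simp) (by simp)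
  simpa [cl, EE] using key

end Invar

section MainStep
set_option linter.unusedSectionVars false
variable {V W : Type} [Fintype V] [DecidableEq V] [Fintype W] [DecidableEq W]
  {G : SimpleGraph V} {H : SimpleGraph W} {N : ℕ} {Good : Finset (V × W) → Prop}

def mkPar (W : Type) (G : SimpleGraph V) (X : Set V) (P : Finset (V × W)) : Par (V × W) where
  P := P
  g := fun s t => ∃ u, u ∈ X ∧ ∃ w, w ∉ X ∧ tp G fs P u = s ∧ tp G fs P w = t ∧ G.Adj u w
  Γ := {c | ∀ y, y ∉ X → col G fs P y ≠ c}

theorem mkPar_loc {k : ℕ} {X A B : Finset V} (h : SP G k X A B) {P : Finset (V × W)}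
    (hP : A ∪ B ⊆ P.image Prod.fst) : Loc G fs (mkPar W G (X : Set V) P) (X : Set V) := by
  refine ⟨?_, ?_, fun x => Iff.rfl⟩
  · intro u hu w hw
    constructor
    · intro hadj
      exact ⟨u, hu, w, hw, rfl, rfl, hadj⟩
    · rintro ⟨u', hu', w', hw', e1, e2, hadj⟩
      change tp G fs P u' = tp G fs P u at e1
      change tp G fs P w' = tp G fs P w at e2
      rw [tp_eq_iff] at e1 e2
      refine (h.det hu hu' hw hw' ?_ ?_).mpr hadj
      · intro b hb
        obtain ⟨p, hp, rfl⟩ := Finset.mem_image.mp (hP (Finset.mem_union_right _ hb))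
        exact (e1 p hp).2.symm
      · intro b hb
        obtain ⟨p, hp, rfl⟩ := Finset.mem_image.mp (hP (Finset.mem_union_left _ hb))
        exact (e2 p hp).2.symm
  · rintro s t ⟨u, hu, w, hw, e1, e2, hadj⟩
    exact ⟨w, hw, e2⟩

theorem mkPar_A_sub {k : ℕ} {X A B : Finset V} (h : SP G k X A B) {P : Finset (V × W)}
    (hP : A ∪ B ⊆ P.image Prod.fst) {a : V} (ha : a ∈ A) (J : Set V) :
    a ∈ ZZ G fs (mkPar W G (X : Set V) P) J := by
  refine sub_cl (Or.inl ?_)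
  intro y hy e
  have e1 : tp G fs P y = tp G fs P a := congrArg Prod.fst e
  rw [tp_eq_iff] at e1
  obtain ⟨p, hp, rfl⟩ := Finset.mem_image.mp (hP (Finset.mem_union_left _ ha))
  have := (e1 p hp).1.mpr rfl
  exact hy (by rw [this]; exact h.hA ha)

theorem Loc.selOK {Q : Type} {pr : Q → V} {a : Par Q} {X Z : Finset V} (h : Loc G pr a (X : Set V))
    (hZX : Z ⊆ X) (hZ : ∀ u ∈ Z, ∀ w, RR G pr a u w → w ∈ Z) : SelOK G X Z := by
  intro w hw hwZ
  have key : ∀ u ∈ Z, (G.Adj u w ↔ a.g (tp G pr a.P u) (tp G pr a.P w)) := by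
    intro u hu
    by_contra hc
    exact hwZ (hZ u hu w hc)
  by_cases hex : ∃ w2, w2 ∉ (X : Set V) ∧ tp G pr a.P w2 = tp G pr a.P w
  · obtain ⟨w2, h1, h2⟩ := hex
    refine Or.inr ⟨w2, h1, fun u hu => ?_⟩
    rw [key u hu, h.det u (hZX hu) w2 h1, h2]
  · refine Or.inl fun u hu hadj => hex ?_
    exact h.gex _ _ ((key u hu).mp hadj)

theorem C_pres {a : Par (V × W)} {Z : Set V} {Z' : Set W} (Φ : V ≃ W)
    (hZ : ZZ G fs a ∅ ⊆ Z) (hZ' : ZZ H sn a ∅ ⊆ Z') (hm : ∀ z, z ∈ Z ↔ Φ z ∈ Z')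
    (ht : ∀ z, tp G fs a.P z = tp H sn a.P (Φ z))
    (hadj : ∀ z ∈ Z, ∀ w, (G.Adj z w ↔ H.Adj (Φ z) (Φ w))) (z : V) :
    z ∈ ZZ G fs a ∅ ↔ Φ z ∈ ZZ H sn a ∅ := by
  have hcol : ∀ z ∈ Z, col G fs a.P z = col H sn a.P (Φ z) := by
    intro z hz
    unfold col
    rw [ht z]
    congr 1
    funext t
    refine Nat.card_congr (Φ.subtypeEquiv fun y => ?_)
    rw [hadj z hz y, ht y]
  have hRR : ∀ z ∈ Z, ∀ w, (RR G fs a z w ↔ RR H sn a (Φ z) (Φ w)) := by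
    intro z hz w
    unfold RR
    rw [hadj z hz w, ht z, ht w]
  constructor
  · intro hz
    refine cl_ind (fun z => Φ z ∈ ZZ H sn a ∅) ?_ ?_ hz
    · rintro x (hx | hx)
      · have hxZ : x ∈ Z := hZ (sub_cl (Or.inl hx))
        refine sub_cl (Or.inl ?_)
        have hx : col G fs a.P x ∈ a.Γ := hx
        rw [hcol x hxZ] at hx
        exact hx
      · exact absurd hx (Set.notMem_empty x)
    · intro x y hx hx' hr
      exact cl_step hx' ((hRR x (hZ hx) y).mp hr)
  · intro hz
    have := cl_ind (fun z' => Φ.symm z' ∈ ZZ G fs a ∅) ?_ ?_ hz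
    · simpa using this
    · rintro x' (hx | hx)
      · have hxZ : x' ∈ Z' := hZ' (sub_cl (Or.inl hx))
        have hxZ2 : Φ.symm x' ∈ Z := by rw [hm]; simpa using hxZ
        refine sub_cl (Or.inl ?_)
        have hx : col H sn a.P x' ∈ a.Γ := hx
        have h2 := hcol _ hxZ2
        rw [Φ.apply_symm_apply] at h2
        rw [← h2] at hx
        exact hx
      · exact absurd hx (Set.notMem_empty x')
    · intro x' y' hx hx' hr
      have hxZ2 : Φ.symm x' ∈ Z := by rw [hm]; simpa using hZ' hx
      have := hRR _ hxZ2 (Φ.symm y')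
      rw [Φ.apply_symm_apply, Φ.apply_symm_apply] at this
      exact cl_step hx' (this.mpr hr)

theorem card_eq_image (pg : PGame G H N Good) {S : Finset (V × W)} (hS : Good S) :
    (S.image Prod.fst).card = S.card := by
  refine Finset.card_image_of_injOn ?_
  intro p hp q hq h
  exact Prod.ext h ((pg.eqv hS p hp q hq).mp h)

theorem extend (pg : PGame G H N Good) {S : Finset (V × W)} (hS : Good S) (D : Finset V)
    (hc : (S.image Prod.fst ∪ D).card ≤ N) :
    ∃ S1, S ⊆ S1 ∧ Good S1 ∧ S1.image Prod.fst = S.image Prod.fst ∪ D := by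
  induction D using Finset.induction_on with
  | empty => exact ⟨S, Finset.Subset.refl _, hS, by simp⟩
  | insert d D hd ih =>
    have hle : S.image Prod.fst ∪ D ⊆ S.image Prod.fst ∪ insert d D :=
      Finset.union_subset_union_right (Finset.subset_insert _ _)
    obtain ⟨S1, h1, h2, h3⟩ := ih ((Finset.card_le_card hle).trans hc)
    by_cases hdS : d ∈ S1.image Prod.fst
    · refine ⟨S1, h1, h2, ?_⟩
      rw [Finset.union_insert, ← h3, Finset.insert_eq_of_mem hdS]
    · obtain ⟨d', hd'⟩ := pg.forth h2 d
      have hlt : S1.card < N := by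
        rw [Finset.union_insert, ← h3, Finset.card_insert_of_notMem hdS, card_eq_image pg h2] at hc
        omega
      refine ⟨insert (d, d') S1, h1.trans (Finset.subset_insert _ _),
        hd' _ (Finset.Subset.refl _) hlt, ?_⟩
      rw [Finset.image_insert, h3, Finset.union_insert]

theorem node_step (pg : PGame G H N Good) {S : Finset (V × W)} (hS : Good S) (hc : S.card + 1 < N)
    {R : RPar (V × W)} (hRP : R.P ⊆ S) {Y : Set V} {Ys : Bool → Set V} (gl : Glob G fs R Y Ys)
    {Y' : Set W} (hY : GInv Good S Y Y')
    (hout : ∀ i, ∀ p ∈ R.P, p ∉ (R.pa i).P → p.1 ∉ Ys i)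
    (hcard : ∀ i, (R.pa i).P.card + 2 < N)
    (ih : ∀ i, ∀ x ∈ Ys i, ∀ x', Good (insert (x, x') S) → ∃ Φ : V ≃ W,
      (∀ z, z ∈ ZZ G fs (R.pa i) {x} ↔ Φ z ∈ ZZ H sn (R.pa i) {x'}) ∧
      (∀ z, tp G fs (R.pa i).P z = tp H sn (R.pa i).P (Φ z)) ∧
      ∀ z ∈ ZZ G fs (R.pa i) {x}, ∀ w, (G.Adj z w ↔ H.Adj (Φ z) (Φ w))) :
    ∃ Φ : V ≃ W, (∀ x, x ∈ Y ↔ Φ x ∈ Y') ∧ (∀ x, tp G fs R.P x = tp H sn R.P (Φ x)) ∧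
      ∀ x ∈ Y, ∀ w, (G.Adj x w ↔ H.Adj (Φ x) (Φ w)) := by
  classical
  have hP : ∀ i, (R.pa i).P ⊆ S := fun i => (gl.sub i).trans hRP
  have hlt : ∀ p : V × W, (insert p S).card < N := fun p =>
    lt_of_le_of_lt (Finset.card_insert_le _ _) hc
  obtain ⟨σ, hσ0⟩ := pg.ext hS
  have hσ : ∀ x, Good (insert (x, σ x) S) := fun x =>
    hσ0 x S (Finset.Subset.refl _) (by omega)
  have Zinv : ∀ i x x', Good (insert (x, x') S) → GInv Good (insert (x, x') (R.pa i).P)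
      (ZZ G fs (R.pa i) {x}) (ZZ H sn (R.pa i) {x'}) := by
    intro i x x' hx
    refine ZZ_inv pg ?_ (Finset.subset_insert _ _) ?_
    · have := Finset.card_insert_le (x, x') (R.pa i).P
      have := hcard i
      omega
    · intro y y' hy
      exact pg.eqv hy (y, y') (by simp) (x, x') (by simp)
  have Cinv := Cc_inv pg hc (R := R) hP
  have H1 : ∀ i, ∀ x ∈ Ys i, ∀ x', Good (insert (x, x') S) → ∀ z', (EE H sn R Y' x' z' ↔
      z' ∈ ZZ H sn (R.pa i) {x'} ∧ (x' ∈ Cc H sn R.pa i ∨ z' ∉ Cc H sn R.pa i)) := by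
    intro i x hx x' hg z'
    obtain ⟨z, hz⟩ := pg.back hg z'
    have hg2 := hz _ (Finset.Subset.refl _) (hlt _)
    have hsub : S ⊆ insert (z, z') (insert (x, x') S) :=
      (Finset.subset_insert _ _).trans (Finset.subset_insert _ _)
    rw [← EE_inv pg hc hP hRP hY hg2, gl.E_iff hx,
      (Cinv i).mem pg hsub hg2 (x := x) (x' := x') (by simp),
      (Cinv i).mem pg hsub hg2 (x := z) (x' := z') (by simp),
      (Zinv i x x' hg).mem pg (T := insert (z, z') (insert (x, x') S)) ?_ hg2
        (x := z) (x' := z') (by simp)]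
    exact (Finset.insert_subset_insert _ (hP i)).trans (Finset.subset_insert _ _)
  have HEt : ∀ x' y', ∃ x y, Good (insert (y, y') (insert (x, x') S)) ∧
      (EE G fs R Y x y ↔ EE H sn R Y' x' y') := by
    intro x' y'
    obtain ⟨x, hx⟩ := pg.back hS x'
    have hg := hx _ (Finset.Subset.refl _) (by omega)
    obtain ⟨y, hy⟩ := pg.back hg y'
    have hg2 := hy _ (Finset.Subset.refl _) (hlt _)
    exact ⟨x, y, hg2, EE_inv pg hc hP hRP hY hg2⟩
  have HEC : ∀ i x' y', EE H sn R Y' x' y' → (x' ∈ Cc H sn R.pa i ↔ y' ∈ Cc H sn R.pa i) := by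
    intro i x' y' he
    obtain ⟨x, y, hg, h1⟩ := HEt x' y'
    have hsub : S ⊆ insert (y, y') (insert (x, x') S) :=
      (Finset.subset_insert _ _).trans (Finset.subset_insert _ _)
    rw [← (Cinv i).mem pg hsub hg (x := x) (x' := x') (by simp),
      ← (Cinv i).mem pg hsub hg (x := y) (x' := y') (by simp)]
    exact gl.E_C (h1.mpr he)
  have HEY : ∀ x' y', EE H sn R Y' x' y' → (x' ∈ Y' ↔ y' ∈ Y') := by
    intro x' y' he
    obtain ⟨x, y, hg, h1⟩ := HEt x' y'
    have hsub : S ⊆ insert (y, y') (insert (x, x') S) :=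
      (Finset.subset_insert _ _).trans (Finset.subset_insert _ _)
    rw [← hY.mem pg hsub hg (x := x) (x' := x') (by simp),
      ← hY.mem pg hsub hg (x := y) (x' := y') (by simp)]
    exact gl.E_Y (h1.mpr he)
  have σY : ∀ x, x ∈ Y ↔ σ x ∈ Y' := fun x => hY x _ (hσ x)
  have σC : ∀ i x, x ∈ Cc G fs R.pa i ↔ σ x ∈ Cc H sn R.pa i := fun i x => Cinv i x _ (hσ x)
  have hΨ : ∀ x, ∃ Φ : V ≃ W, (∀ y, EE G fs R Y x y ↔ EE H sn R Y' (σ x) (Φ y)) ∧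
      (x ∉ Y → Φ = σ) ∧ ∀ i, x ∈ Ys i →
      (∀ z, z ∈ ZZ G fs (R.pa i) {x} ↔ Φ z ∈ ZZ H sn (R.pa i) {σ x}) ∧
      (∀ z, tp G fs (R.pa i).P z = tp H sn (R.pa i).P (Φ z)) ∧
      ∀ z ∈ ZZ G fs (R.pa i) {x}, ∀ w, (G.Adj z w ↔ H.Adj (Φ z) (Φ w)) := by
    intro x
    by_cases hx : x ∈ Y
    · obtain ⟨i, hi⟩ := (gl.cov x).mp hx
      obtain ⟨Φ, h1, h2, h3⟩ := ih i x hi (σ x) (hσ x)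
      refine ⟨Φ, ?_, fun h => absurd hx h, ?_⟩
      · intro y
        rw [gl.E_iff hi, H1 i x hi _ (hσ x), h1 y, σC i x]
        have : y ∈ Cc G fs R.pa i ↔ Φ y ∈ Cc H sn R.pa i :=
          C_pres Φ (fun _ h => ZZ_empty_sub h) (fun _ h => ZZ_empty_sub h) h1 h2 h3 y
        rw [this]
      · intro j hj
        have := gl.disj x i j hi hj
        subst this
        exact ⟨h1, h2, h3⟩
    · refine ⟨σ, ?_, fun _ => rfl, fun i hi => absurd ((gl.cov x).mpr ⟨i, hi⟩) hx⟩
      intro y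
      rw [gl.E_out_iff hx, σY y]
      constructor
      · intro hy
        exact Relation.ReflTransGen.single (Or.inl ⟨by rwa [← σY], hy⟩)
      · intro he
        rw [← HEY _ _ he, ← σY]
        exact hx
  choose Ψ hΨ1 hΨ2 hΨ3 using hΨ
  obtain ⟨Φ, ρ, r1, r2, r3, r4, r5⟩ := assembly (⟨_, EE_equiv G fs R Y⟩ : Setoid V)
    (⟨_, EE_equiv H sn R Y'⟩ : Setoid W) σ Ψ hΨ1
  change ∀ y, EE G fs R Y (ρ y) y at r1
  change ∀ y z, EE G fs R Y y z → ρ y = ρ z at r2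
  change ∀ y z, EE G fs R Y y z ↔ EE H sn R Y' (Φ y) (Φ z) at r4
  change ∀ y, EE H sn R Y' (σ (ρ y)) (Φ y) at r5
  have ΦY : ∀ x, x ∈ Y ↔ Φ x ∈ Y' := fun x => by
    rw [← gl.E_Y (r1 x), ← HEY _ _ (r5 x), σY]
  have ΦC : ∀ i x, x ∈ Cc G fs R.pa i ↔ Φ x ∈ Cc H sn R.pa i := fun i x => by
    rw [← gl.E_C (r1 x), ← HEC i _ _ (r5 x), σC]
  -- representatives stay in the same side
  have ρY : ∀ i, ∀ y ∈ Ys i, ρ y ∈ Ys i ∧ y ∈ ZZ G fs (R.pa i) {ρ y} := by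
    intro i y hy
    have h1 : ρ y ∈ Y := (gl.E_Y (r1 y)).mpr ((gl.cov y).mpr ⟨i, hy⟩)
    obtain ⟨j, hj⟩ := (gl.cov _).mp h1
    have h2 := ((gl.E_iff hj).mp (r1 y)).1
    have h3 : y ∈ Ys j := (gl.loc j).Z_sub (Set.singleton_subset_iff.mpr hj) h2
    have := gl.disj y i j hy h3
    subst this
    exact ⟨hj, h2⟩
  have f1 : ∀ z, tp G fs R.P z = tp H sn R.P (Φ z) := by
    intro z
    by_cases hz : z ∈ Y
    · obtain ⟨i, hi⟩ := (gl.cov z).mp hz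
      obtain ⟨hρ, hzρ⟩ := ρY i z hi
      obtain ⟨h1, h2, h3⟩ := hΨ3 (ρ z) i hρ
      have hzt := h2 z
      have hzm := (h1 z).mp hzρ
      rw [← r3] at hzt hzm
      have hzt' := tp_eq_iff.mp hzt
      rw [tp_eq_iff]
      intro p hp
      by_cases hpi : p ∈ (R.pa i).P
      · exact hzt' p hpi
      · have hp1 := hout i p hp hpi
        have hZs : ZZ G fs (R.pa i) {ρ z} ⊆ Ys i :=
          (gl.loc i).Z_sub (Set.singleton_subset_iff.mpr hρ)
        have hpZ : p.1 ∉ ZZ G fs (R.pa i) {ρ z} := fun hh => hp1 (hZs hh)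
        have hpZ' : p.2 ∉ ZZ H sn (R.pa i) {σ (ρ z)} := by
          rw [← (Zinv i _ _ (hσ (ρ z))).mem pg (T := insert (ρ z, σ (ρ z)) S)
            (Finset.insert_subset_insert _ (hP i)) (hσ (ρ z)) (x := p.1) (x' := p.2)
            (Finset.mem_insert_of_mem (hRP hp))]
          exact hpZ
        have n1 : ¬ RR G fs (R.pa i) z p.1 := fun hh => hpZ (cl_step hzρ hh)
        have n2 : ¬ RR H sn (R.pa i) (Φ z) p.2 := fun hh => hpZ' (cl_step hzm hh)
        unfold RR at n1 n2
        rw [not_not] at n1 n2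
        have htp : tp G fs (R.pa i).P p.1 = tp H sn (R.pa i).P p.2 :=
          tp_inv pg (hP i) hS (hRP hp)
        constructor
        · constructor
          · intro hh
            exact absurd hh (ne_of_mem_of_not_mem hzρ hpZ)
          · intro hh
            exact absurd hh (ne_of_mem_of_not_mem hzm hpZ')
        · change G.Adj z p.1 ↔ H.Adj (Φ z) p.2
          rw [n1, n2, hzt, htp]
    · have hρ : ρ z ∉ Y := by rwa [gl.E_Y (r1 z)]
      rw [r3, hΨ2 _ hρ]
      exact tp_inv pg (hRP.trans (Finset.subset_insert _ _)) (hσ z) (Finset.mem_insert_self _ _)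
  have L : ∀ i, ∀ y ∈ Ys i, ∀ z, z ∉ ZZ G fs (R.pa i) {y} → (G.Adj y z ↔ H.Adj (Φ y) (Φ z)) := by
    intro i y hy z hz
    obtain ⟨hρ, hyρ⟩ := ρY i y hy
    obtain ⟨h1, h2, h3⟩ := hΨ3 (ρ y) i hρ
    have hym := (h1 y).mp hyρ
    rw [← r3] at hym
    have n1 : ¬ RR G fs (R.pa i) y z := fun hh => hz (cl_step self_mem_ZZ hh)
    have n2 : ¬ RR H sn (R.pa i) (Φ y) (Φ z) := by
      intro hh
      have hzm : Φ z ∈ ZZ H sn (R.pa i) {σ (ρ y)} := cl_step hym hh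
      by_cases hzC : Φ z ∈ Cc H sn R.pa i
      · rw [← ΦC] at hzC
        exact hz (ZZ_empty_sub hzC)
      · have he := (H1 i (ρ y) hρ _ (hσ _) (Φ z)).mpr ⟨hzm, Or.inr hzC⟩
        have he2 := (EE_equiv H sn R Y').trans ((EE_equiv H sn R Y').symm (r5 y)) he
        rw [← r4] at he2
        exact hz ((gl.E_iff hy).mp he2).1
    unfold RR at n1 n2
    rw [not_not] at n1 n2
    rw [n1, n2, tp_mono (gl.sub i) (f1 y), tp_mono (gl.sub i) (f1 z)]
  refine ⟨Φ, ΦY, f1, ?_⟩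
  intro y hyY z
  obtain ⟨i, hy⟩ := (gl.cov y).mp hyY
  by_cases he : EE G fs R Y y z
  · obtain ⟨hρ, hyρ⟩ := ρY i y hy
    obtain ⟨h1, h2, h3⟩ := hΨ3 (ρ y) i hρ
    rw [r3 y, r3 z, ← r2 y z he]
    exact h3 y hyρ z
  · by_cases hz : z ∈ ZZ G fs (R.pa i) {y}
    · rw [gl.E_iff hy] at he
      push Not at he
      obtain ⟨hyC, hzC⟩ := he hz
      have := L i z (gl.C_sub hzC) y (by rw [ZZ_eq_of_mem hzC]; exact hyC)
      rw [G.adj_comm, H.adj_comm]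
      exact this
    · exact L i y hy z hz

end MainStep

section MainThm
set_option linter.unusedSectionVars false
variable {V W : Type} [Fintype V] [DecidableEq V] [Fintype W] [DecidableEq W]
  {G : SimpleGraph V} {H : SimpleGraph W} {Good : Finset (V × W) → Prop}

open Classical in
theorem main_claim {k : ℕ} (pg : PGame G H (3 * k + 3) Good) (n : ℕ) :
    ∀ (Y A B : Finset V) (v : V) (S : Finset (V × W)) (Y' : Set W), Y.card ≤ n → Dec G k Y →
    SP G k Y A B → Good S → A ∪ B ⊆ S.image Prod.fst → S.image Prod.fst ⊆ insert v (A ∪ B) →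
    GInv Good S (Y : Set V) Y' →
    ∃ Φ : V ≃ W, (∀ x, x ∈ (Y : Set V) ↔ Φ x ∈ Y') ∧
      (∀ x, tp G fs (S.filter (fun p => p.1 ∈ A ∪ B)) x =
        tp H sn (S.filter (fun p => p.1 ∈ A ∪ B)) (Φ x)) ∧
      ∀ x ∈ (Y : Set V), ∀ w, (G.Adj x w ↔ H.Adj (Φ x) (Φ w)) := by
  induction n with
  | zero =>
    intro Y A B v S Y' hn hd
    have := hd.nonempty
    rw [← Finset.card_pos] at this
    omega
  | succ n ih =>
    intro Y A B v S Y' hn hd sp hS hAB hABS hY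
    have cardS : S.card ≤ 2 * k + 1 := by
      rw [← card_eq_image pg hS]
      refine (Finset.card_le_card hABS).trans ((Finset.card_insert_le _ _).trans ?_)
      have := Finset.card_union_le A B
      have := sp.hAc
      have := sp.hBc
      omega
    cases hd with
    | leaf y =>
      obtain ⟨y', hy'⟩ := pg.forth hS y
      have hg := hy' _ (Finset.Subset.refl _) (by omega)
      obtain ⟨σ, hσ⟩ := pg.ext hg
      have hcard : (insert (y, y') S).card < 3 * k + 3 :=
        lt_of_le_of_lt (Finset.card_insert_le _ _) (by omega)
      have hσ1 : ∀ x, Good (insert (x, σ x) (insert (y, y') S)) := fun x =>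
        hσ x _ (Finset.Subset.refl _) hcard
      have hyy : σ y = y' := ((pg.eqv (hσ1 y) (y, σ y) (by simp) (y, y') (by simp)).mp rfl)
      refine ⟨σ, fun x => ?_, fun x => ?_, ?_⟩
      · exact hY.mem pg ((Finset.subset_insert _ _).trans (Finset.subset_insert _ _)) (hσ1 x)
          (Finset.mem_insert_self _ _)
      · exact tp_inv pg ((Finset.filter_subset _ _).trans ((Finset.subset_insert _ _).trans
          (Finset.subset_insert _ _))) (hσ1 x) (Finset.mem_insert_self _ _)
      · intro x hx w
        have hx : x = y := by simpa using hx
        subst hx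
        have := pg.adj (hσ1 w) (x, y') (by simp) (w, σ w) (by simp)
        rw [hyy]
        exact this
    | node X1 X2 hdis hd1 hd2 hl1 hl2 =>
      obtain ⟨A1, A2, B1, B2, sp1, sp2, hA, hB1, hB2⟩ := sp.nice hdis hl1 hl2
      -- extend the position
      have hsub1 : S.image Prod.fst ∪ (A1 ∪ A2) ⊆ insert v (A1 ∪ A2 ∪ B) := by
        intro x hx
        rcases Finset.mem_union.mp hx with hx | hx
        · have := hABS hx
          simp only [Finset.mem_insert, Finset.mem_union] at this ⊢
          rcases this with h | h | h
          · exact Or.inl h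
          · have := Finset.mem_union.mp (hA h)
            tauto
          · tauto
        · simp only [Finset.mem_insert, Finset.mem_union] at hx ⊢
          tauto
      have hcd : (insert v (A1 ∪ A2 ∪ B)).card ≤ 3 * k + 1 := by
        have h1 := Finset.card_insert_le v (A1 ∪ A2 ∪ B)
        have h2 := Finset.card_union_le (A1 ∪ A2) B
        have h3 := Finset.card_union_le A1 A2
        have := sp1.hAc
        have := sp2.hAc
        have := sp.hBc
        omega
      have hcd2 := (Finset.card_le_card hsub1).trans hcd
      obtain ⟨S1, hSS, hS1, him⟩ := extend pg hS (A1 ∪ A2) (by omega)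
      have cardS1 : S1.card ≤ 3 * k + 1 := by
        rw [← card_eq_image pg hS1, him]; exact hcd2
      let As : Bool → Finset V := fun i => if i then A1 else A2
      let Bs : Bool → Finset V := fun i => if i then B1 else B2
      let Xs : Bool → Finset V := fun i => if i then X1 else X2
      have sps : ∀ i, SP G k (Xs i) (As i) (Bs i) := by
        intro i; cases i
        · exact sp2
        · exact sp1
      have decs : ∀ i, Dec G k (Xs i) := by
        intro i; cases i
        · exact hd2
        · exact hd1
      let P := S1.filter (fun p => p.1 ∈ A1 ∪ A2 ∪ B)
      let Ps : Bool → Finset (V × W) := fun i => S1.filter (fun p => p.1 ∈ As i ∪ Bs i)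
      have hAsub : ∀ i, As i ∪ Bs i ⊆ A1 ∪ A2 ∪ B := by
        intro i x hx
        have hx := Finset.mem_union.mp hx
        cases i
        · change x ∈ A2 ∨ x ∈ B2 at hx
          rcases hx with hx | hx
          · simp [hx]
          · have := Finset.mem_union.mp (hB2 hx)
            simp only [Finset.mem_union]; tauto
        · change x ∈ A1 ∨ x ∈ B1 at hx
          rcases hx with hx | hx
          · simp [hx]
          · have := Finset.mem_union.mp (hB1 hx)
            simp only [Finset.mem_union]; tauto
      have hBS : A1 ∪ A2 ∪ B ⊆ S1.image Prod.fst := by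
        rw [him]
        intro x hx
        rcases Finset.mem_union.mp hx with hx | hx
        · exact Finset.mem_union_right _ hx
        · exact Finset.mem_union_left _ (hAB (Finset.mem_union_right _ hx))
      have hPs : ∀ i, As i ∪ Bs i ⊆ (Ps i).image Prod.fst := by
        intro i x hx
        obtain ⟨p, hp, rfl⟩ := Finset.mem_image.mp (hBS (hAsub i hx))
        exact Finset.mem_image.mpr ⟨p, Finset.mem_filter.mpr ⟨hp, hx⟩, rfl⟩
      have hPs2 : ∀ i, (Ps i).image Prod.fst ⊆ As i ∪ Bs i := by
        intro i x hx
        obtain ⟨p, hp, rfl⟩ := Finset.mem_image.mp hx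
        exact (Finset.mem_filter.mp hp).2
      have hPsS : ∀ i, Ps i ⊆ S1 := fun i => Finset.filter_subset _ _
      have hPsc : ∀ i, (Ps i).card ≤ 2 * k := by
        intro i
        rw [← card_eq_image pg (pg.mono (hPsS i) hS1)]
        refine (Finset.card_le_card (hPs2 i)).trans ((Finset.card_union_le _ _).trans ?_)
        have := (sps i).hAc
        have := (sps i).hBc
        omega
      let pa : Bool → Par (V × W) := fun i => mkPar W G (Xs i : Set V) (Ps i)
      let R : RPar (V × W) :=
        ⟨P, pa, fun j => {t | ∃ y, y ∈ Rest G fs pa ((X1 ∪ X2 : Finset V) : Set V) ∧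
          y ∈ (Xs j : Set V) ∧ tp G fs P y = t}⟩
      have loc : ∀ i, Loc G fs (pa i) (Xs i : Set V) := fun i => mkPar_loc (sps i) (hPs i)
      have disj : ∀ x i j, x ∈ (Xs i : Set V) → x ∈ (Xs j : Set V) → i = j := by
        intro x i j hi hj
        have hh : x ∈ X1 → x ∉ X2 := fun h => Finset.disjoint_left.mp hdis h
        cases i <;> cases j
        · rfl
        · exact absurd hi (hh hj)
        · exact absurd hj (hh hi)
        · rfl
      have gl : Glob G fs R ((X1 ∪ X2 : Finset V) : Set V) (fun i => (Xs i : Set V)) := by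
        refine ⟨loc, ?_, disj, ?_, fun t j => Iff.rfl⟩
        · intro x
          rw [Finset.mem_coe, Finset.mem_union]
          constructor
          · rintro (h | h)
            · exact ⟨true, h⟩
            · exact ⟨false, h⟩
          · rintro ⟨i, hi⟩
            cases i
            · exact Or.inr hi
            · exact Or.inl hi
        · intro i p hp
          have hp := Finset.mem_filter.mp hp
          exact Finset.mem_filter.mpr ⟨hp.1, hAsub i hp.2⟩
      have hY1 : GInv Good S1 ((X1 ∪ X2 : Finset V) : Set V) Y' := fun x x' hx =>
        hY x x' (pg.mono (Finset.insert_subset_insert _ hSS) hx)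
      have hlt : ∀ i, (Xs i).card ≤ n := by
        have h1 := Finset.card_union_of_disjoint hdis
        have h2 := Finset.card_pos.mpr hd1.nonempty
        have h3 := Finset.card_pos.mpr hd2.nonempty
        intro i
        cases i
        · change X2.card ≤ n; omega
        · change X1.card ≤ n; omega
      have ns := node_step pg hS1 (by omega) (R := R) (Finset.filter_subset _ _) gl hY1
      refine Exists.elim (ns ?_ ?_ ?_) ?_
      · intro i p hp hpi hx
        have hp := Finset.mem_filter.mp hp
        have hpA : p.1 ∉ As i := fun h => hpi (Finset.mem_filter.mpr
          ⟨hp.1, Finset.mem_union_left _ h⟩)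
        have hp2 := hp.2
        rw [Finset.mem_union, Finset.mem_union] at hp2
        have hBn : p.1 ∈ B → False := by
          intro hb
          have := Finset.mem_compl.mp (sp.hB hb)
          apply this
          cases i
          · exact Finset.mem_union_right _ hx
          · exact Finset.mem_union_left _ hx
        rcases hp2 with (h | h) | h
        · cases i
          · simpa using disj p.1 true false (sp1.hA h) hx
          · exact hpA h
        · cases i
          · exact hpA h
          · simpa using disj p.1 false true (sp2.hA h) hx
        · exact hBn h
      · intro i
        have := hPsc i
        change (Ps i).card + 2 < 3 * k + 3
        omega
      · intro i x hx x' hg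
        change ∃ Φ : V ≃ W,
          (∀ z, z ∈ ZZ G fs (pa i) {x} ↔ Φ z ∈ ZZ H sn (pa i) {x'}) ∧
          (∀ z, tp G fs (Ps i) z = tp H sn (Ps i) (Φ z)) ∧
          ∀ z ∈ ZZ G fs (pa i) {x}, ∀ w, (G.Adj z w ↔ H.Adj (Φ z) (Φ w))
        have hx : x ∈ (Xs i : Set V) := hx
        obtain ⟨Z, hZ⟩ : ∃ Z : Finset V, (Z : Set V) = ZZ G fs (pa i) {x} :=
          ⟨(Set.toFinite (ZZ G fs (pa i) {x})).toFinset, by simp⟩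
        have hZm : ∀ z, z ∈ Z ↔ z ∈ ZZ G fs (pa i) {x} := fun z => by rw [← hZ, Finset.mem_coe]
        have hZX : Z ⊆ Xs i := fun z hz =>
          (loc i).Z_sub (Set.singleton_subset_iff.mpr hx) ((hZm z).mp hz)
        have hsel : SelOK G (Xs i) Z := (loc i).selOK hZX (fun u hu w hr =>
          (hZm w).mpr (cl_step ((hZm u).mp hu) hr))
        have hint : Xs i ∩ Z = Z := Finset.inter_eq_right.mpr hZX
        have hxZ : x ∈ Z := (hZm x).mpr self_mem_ZZ
        have hdZ : Dec G k Z := by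
          have := Dec.restrict hsel (decs i) (Finset.Subset.refl _) (by rw [hint]; exact ⟨x, hxZ⟩)
          rwa [hint] at this
        have hspZ : SP G k Z (As i) (Bs i) := (sps i).restrict
          (fun a ha => (hZm a).mpr (mkPar_A_sub (sps i) (hPs i) ha _)) hZX hsel
        have hgP : Good (insert (x, x') (Ps i)) :=
          pg.mono (Finset.insert_subset_insert _ (hPsS i)) hg
        have hci : (insert (x, x') (Ps i)).card + 1 < 3 * k + 3 := by
          have := Finset.card_insert_le (x, x') (Ps i)
          have := hPsc i
          omega
        have hinv : GInv Good (insert (x, x') (Ps i)) (Z : Set V) (ZZ H sn (pa i) {x'}) := by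
          rw [hZ]
          refine ZZ_inv pg hci (Finset.subset_insert _ _) ?_
          intro y y' hy
          exact pg.eqv hy (y, y') (by simp) (x, x') (by simp)
        obtain ⟨Φ, h1, h2, h3⟩ := ih Z (As i) (Bs i) x (insert (x, x') (Ps i))
          (ZZ H sn (pa i) {x'}) ((Finset.card_le_card hZX).trans (hlt i)) hdZ hspZ hgP
          ((hPs i).trans (Finset.image_subset_image (Finset.subset_insert _ _)))
          (by rw [Finset.image_insert]; exact Finset.insert_subset_insert _ (hPs2 i)) hinv
        rw [hZ] at h1 h3
        refine ⟨Φ, h1, fun z => tp_mono ?_ (h2 z), h3⟩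
        intro p hp
        exact Finset.mem_filter.mpr ⟨Finset.mem_insert_of_mem hp, (Finset.mem_filter.mp hp).2⟩
      · rintro Φ ⟨h1, h2, h3⟩
        refine ⟨Φ, h1, fun x => tp_mono ?_ (h2 x), h3⟩
        intro p hp
        have hp := Finset.mem_filter.mp hp
        refine Finset.mem_filter.mpr ⟨hSS hp.1, ?_⟩
        rcases Finset.mem_union.mp hp.2 with h | h
        · exact Finset.mem_union_left _ (hA h)
        · exact Finset.mem_union_right _ h

end MainThm

theorem wl_dimension_rankwidth_le (k : ℕ) (hk : 1 ≤ k)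
    (V W : Type) [Fintype V] [DecidableEq V] [Fintype W] [DecidableEq W]
    (G : SimpleGraph V) (H : SimpleGraph W)
    (hG : RankwidthLE G k) (hGH : ¬ Nonempty (G ≃g H)) :
    ∃ r : ℕ, wlMultiset G (fun _ => ()) (3 * k + 3) r ≠ wlMultiset H (fun _ => ()) (3 * k + 3) r := by
  by_contra hcon
  push Not at hcon
  obtain ⟨t, ht, hs⟩ := hG
  have hnd : t.leaves.Nodup := by rw [ht]; exact Finset.univ.nodup
  have hd := (dec_of_tree t hnd hs).1
  have hu : t.leaves.toFinset = Finset.univ := by rw [ht]; ext; simp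
  rw [hu] at hd
  obtain ⟨v, _⟩ := hd.nonempty
  have : Nonempty V := ⟨v⟩
  have pg := wlGood_game G H (3 * k + 3)
  have h0 := wlGood_empty G H (3 * k + 3) hcon
  obtain ⟨Φ, _, _, h3⟩ := main_claim pg (Finset.univ : Finset V).card Finset.univ ∅ ∅ v ∅
    (Set.univ : Set W) le_rfl hd (SP_univ G k) h0 (by simp) (by simp)
    (fun x x' _ => by simp)
  exact hGH ⟨⟨Φ, fun {a b} => (h3 a (by simp) b).symm⟩⟩
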